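/- Let ω be a non-quasianalytic weight function and let L := (D_x − ½ y)² + (D_y + ½ x)² be the twisted Laplacian, acting on 𝒮′_ω(ℝ²) as a linear partial differential operator with polynomial coefficients. Then L is ω-regular: for every u ∈ 𝒮′_ω(ℝ²), Lu ∈ 𝒮_ω(ℝ²) implies u ∈ 𝒮_ω(ℝ²). -/

import Mathlib

/-!
STATEMENT 19. Let `ω` be a non-quasianalytic weight function and
`L = (D_x - ½y)² + (D_y + ½x)²` the twisted Laplacian, acting on `𝒮'_ω(ℝ²)` (by duality).
Then `L` is `ω`-regular: `Lu ∈ 𝒮_ω(ℝ²)` implies `u ∈ 𝒮_ω(ℝ²)` for every `u ∈ 𝒮'_ω(ℝ²)`.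

Elements of `𝒮'_ω(ℝ²)` are modeled as linear functionals on
`𝒮_ω(ℝ²) = {f ∈ 𝓢(ℝ²,ℂ) | SOmega2 ω f}` that are continuous for the natural seminorms; the
action of `L` on `𝒮'_ω` is characterized by duality `⟨Lu, φ⟩ = ⟨u, L^t φ⟩`, where
`L^t = (D₁ + ½M₂)² + (D₂ - ½M₁)²` is the formal transpose of `L`.
-/
noncomputable section
open MeasureTheory Complex Real SchwartzMap
open scoped ENNReal

/-- A non-quasianalytic weight function. -/
structure IsWeightFn (ω : ℝ → ℝ) : Prop where
  cont : ContinuousOn ω (Set.Ici 0)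
  mono : MonotoneOn ω (Set.Ici 0)
  nonneg : ∀ t, 0 ≤ t → 0 ≤ ω t
  alpha : ∃ L > 0, ∀ t, 0 ≤ t → ω (2 * t) ≤ L * (ω t + 1)
  beta : MeasureTheory.IntegrableOn (fun t => ω t / t ^ 2) (Set.Ici 1)
  gamma : ∃ a : ℝ, ∃ b > 0, ∀ t, 0 ≤ t → a + b * Real.log (1 + t) ≤ ω t
  delta : ConvexOn ℝ (Set.Ici 0) fun t => ω (Real.exp t)

/-- `e^{λ φ*(m/λ)} = sup_{s ≥ 0} e^{m s - λ ω(e^s)} ∈ ℝ≥0∞`. -/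
def expPhiStar (ω : ℝ → ℝ) (lam m : ℝ) : ℝ≥0∞ :=
  ⨆ s : Set.Ici (0 : ℝ), ENNReal.ofReal (Real.exp (m * s - lam * ω (Real.exp s)))

abbrev Fn2 := ℝ × ℝ → ℂ

def M1 : Fn2 → Fn2 := fun f p => p.1 * f p
def M2 : Fn2 → Fn2 := fun f p => p.2 * f p
def D1 : Fn2 → Fn2 := fun f p => -Complex.I * fderiv ℝ f p (1, 0)
def D2 : Fn2 → Fn2 := fun f p => -Complex.I * fderiv ℝ f p (0, 1)

/-- The Wigner-like transform. -/
def Wig (w : Fn2) : Fn2 :=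
  fun p => ∫ t : ℝ, Complex.exp (-Complex.I * t * p.2) * w (p.1 + t / 2, p.1 - t / 2)

/-- Fourier transform on ℝ², convention `𝓕f(ξ) = ∫ e^{-i⟨x,ξ⟩} f(x) dx`. -/
def FT2 (f : Fn2) : Fn2 :=
  fun ξ => ∫ p : ℝ × ℝ, Complex.exp (-Complex.I * ((p.1 * ξ.1 + p.2 * ξ.2 : ℝ) : ℂ)) * f p

/-- Inverse Fourier transform on ℝ². -/
def FT2inv (g : Fn2) : Fn2 :=
  fun x => ((2 * Real.pi : ℝ) : ℂ)⁻¹ ^ 2 *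
    ∫ ξ : ℝ × ℝ, Complex.exp (Complex.I * ((x.1 * ξ.1 + x.2 * ξ.2 : ℝ) : ℂ)) * g ξ

/-- Membership in `𝒮_ω(ℝ²)` for a Schwartz function: for all `λ > 0` and all multi-indices,
`sup e^{λω(|x|)}|D^α f(x)| < ∞` and `sup e^{λω(|ξ|)}|D^α 𝓕f(ξ)| < ∞`. -/
def SOmega2 (ω : ℝ → ℝ) (f : 𝓢(ℝ × ℝ, ℂ)) : Prop :=
  (∀ lam > (0 : ℝ), ∀ a b : ℕ, ∃ C : ℝ, ∀ p : ℝ × ℝ,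
    Real.exp (lam * ω (Real.sqrt (p.1 ^ 2 + p.2 ^ 2))) * ‖D1^[a] (D2^[b] ⇑f) p‖ ≤ C) ∧
  (∀ lam > (0 : ℝ), ∀ a b : ℕ, ∃ C : ℝ, ∀ ξ : ℝ × ℝ,
    Real.exp (lam * ω (Real.sqrt (ξ.1 ^ 2 + ξ.2 ^ 2))) * ‖D1^[a] (D2^[b] (FT2 ⇑f)) ξ‖ ≤ C)

/-- The fundamental system of seminorms of `𝒮_ω(ℝ²)`:
`p_λ(f) = sup_{α,β,x} |x^β D^α f(x)| e^{-λφ*((|α|+|β|)/λ)}`. -/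
def pSemi2 (ω : ℝ → ℝ) (lam : ℝ) (f : 𝓢(ℝ × ℝ, ℂ)) : ℝ :=
  ⨆ q : (ℕ × ℕ) × (ℕ × ℕ) × ℝ × ℝ,
    |q.2.2.1 ^ q.2.1.1 * q.2.2.2 ^ q.2.1.2| *
      ‖D1^[q.1.1] (D2^[q.1.2] ⇑f) (q.2.2.1, q.2.2.2)‖ *
      ((expPhiStar ω lam ((q.1.1 + q.1.2 + q.2.1.1 + q.2.1.2 : ℕ) : ℝ))⁻¹).toReal

/-- The space `𝒮'_ω(ℝ²)`: continuous linear functionals on `𝒮_ω(ℝ²)`. -/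
structure OmegaDist2 (ω : ℝ → ℝ) where
  toFun : {f : 𝓢(ℝ × ℝ, ℂ) // SOmega2 ω f} → ℂ
  map_add' : ∀ f g h : {f : 𝓢(ℝ × ℝ, ℂ) // SOmega2 ω f},
    h.1 = f.1 + g.1 → toFun h = toFun f + toFun g
  map_smul' : ∀ (c : ℂ) (f g : {f : 𝓢(ℝ × ℝ, ℂ) // SOmega2 ω f}),
    g.1 = c • f.1 → toFun g = c * toFun f
  cont' : ∃ lam > (0 : ℝ), ∃ C : ℝ, ∀ f, ‖toFun f‖ ≤ C * pSemi2 ω lam f.1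

/-- `u ∈ 𝒮'_ω(ℝ²)` is represented by the function `g` (`u = ∫ g ⬝ -` on `𝒮_ω`). -/
def RepOD2 (ω : ℝ → ℝ) (u : OmegaDist2 ω) (g : Fn2) : Prop :=
  ∀ f : {f : 𝓢(ℝ × ℝ, ℂ) // SOmega2 ω f}, u.toFun f = ∫ p : ℝ × ℝ, g p * f.1 p

/-- `u ∈ 𝒮'_ω(ℝ²)` belongs to `𝒮_ω(ℝ²)`. -/
def InSomega2 (ω : ℝ → ℝ) (u : OmegaDist2 ω) : Prop :=
  ∃ g : 𝓢(ℝ × ℝ, ℂ), SOmega2 ω g ∧ RepOD2 ω u ⇑g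

/-- `ω`-regularity: `A u ∈ 𝒮_ω` implies `u ∈ 𝒮_ω`. -/
def RegOD2 (ω : ℝ → ℝ) (A : OmegaDist2 ω → OmegaDist2 ω) : Prop :=
  ∀ u : OmegaDist2 ω, InSomega2 ω (A u) → InSomega2 ω u

/-- `A' : 𝒮'_ω → 𝒮'_ω` is the operator whose (formal) transpose on `𝒮_ω` is `K`:
`⟨A' u, φ⟩ = ⟨u, K φ⟩`. -/
def DualCharOD2 (ω : ℝ → ℝ) (A' : OmegaDist2 ω → OmegaDist2 ω) (K : Fn2 → Fn2) : Prop :=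
  ∀ (u : OmegaDist2 ω) (φ ψ : {f : 𝓢(ℝ × ℝ, ℂ) // SOmega2 ω f}),
    ⇑ψ.1 = K ⇑φ.1 → (A' u).toFun φ = u.toFun ψ

/-- The twisted Laplacian `L = (D₁ - ½M₂)² + (D₂ + ½M₁)²` on functions. -/
def Ltwist : Fn2 → Fn2 :=
  fun f => (D1 - ((1 : ℂ) / 2) • M2) ((D1 - ((1 : ℂ) / 2) • M2) f) +
    (D2 + ((1 : ℂ) / 2) • M1) ((D2 + ((1 : ℂ) / 2) • M1) f)

/-- The formal transpose of the twisted Laplacian: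
`L^t = (D₁ + ½M₂)² + (D₂ - ½M₁)²` (recall `D^t = -D`, `M^t = M`). -/
def LtwistT : Fn2 → Fn2 :=
  fun f => (D1 + ((1 : ℂ) / 2) • M2) ((D1 + ((1 : ℂ) / 2) • M2) f) +
    (D2 - ((1 : ℂ) / 2) • M1) ((D2 - ((1 : ℂ) / 2) • M1) f)

lemma D1_eq_of_hasFDerivAt {f : Fn2} {p : ℝ × ℝ} {f' : ℝ × ℝ →L[ℝ] ℂ} (h : HasFDerivAt f f' p) :
    D1 f p = -Complex.I * f' (1, 0) := by rw [D1, h.fderiv]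

lemma D2_eq_of_hasFDerivAt {f : Fn2} {p : ℝ × ℝ} {f' : ℝ × ℝ →L[ℝ] ℂ} (h : HasFDerivAt f f' p) :
    D2 f p = -Complex.I * f' (0, 1) := by rw [D2, h.fderiv]

/-- The derivative of a function on `ℝ²` in terms of `D1` and `D2`. -/
lemma fderiv_eq_D1_D2 (f : Fn2) (p : ℝ × ℝ) :
    fderiv ℝ f p = (ContinuousLinearMap.fst ℝ ℝ ℝ).smulRight (Complex.I * D1 f p) +
      (ContinuousLinearMap.snd ℝ ℝ ℝ).smulRight (Complex.I * D2 f p) := by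
  ext <;> simp [D1, D2, ← mul_assoc]

lemma fderiv_apply_eq_D1_D2 (f : Fn2) (p v : ℝ × ℝ) :
    fderiv ℝ f p v = Complex.I * (v.1 * D1 f p + v.2 * D2 f p) := by
  rw [fderiv_eq_D1_D2]; simp; ring

lemma ContDiff.D1 {f : Fn2} (hf : ContDiff ℝ (⊤ : ℕ∞) f) : ContDiff ℝ (⊤ : ℕ∞) (D1 f) :=
  contDiff_const.mul ((hf.fderiv_right le_rfl).clm_apply contDiff_const)

lemma ContDiff.D2 {f : Fn2} (hf : ContDiff ℝ (⊤ : ℕ∞) f) : ContDiff ℝ (⊤ : ℕ∞) (D2 f) :=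
  contDiff_const.mul ((hf.fderiv_right le_rfl).clm_apply contDiff_const)

lemma ContDiff.iterate_D2 {f : Fn2} (hf : ContDiff ℝ (⊤ : ℕ∞) f) (b : ℕ) : ContDiff ℝ (⊤ : ℕ∞) (_root_.D2^[b] f) := by
  induction b with
  | zero => exact hf
  | succ b ih => rw [Function.iterate_succ_apply']; exact ih.D2

lemma D1_D2_comm {f : Fn2} (hf : ContDiff ℝ (⊤ : ℕ∞) f) : D1 (D2 f) = D2 (D1 f) := by
  have hd : Differentiable ℝ (fderiv ℝ f) :=
    (hf.fderiv_right (m := (⊤ : ℕ∞)) le_rfl).differentiable (by simp)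
  have key : ∀ (v w p : ℝ × ℝ), fderiv ℝ (fun q => -Complex.I * fderiv ℝ f q v) p w =
      -Complex.I * fderiv ℝ (fderiv ℝ f) p w v := by
    intro v w p
    have h := ((hd p).hasFDerivAt.clm_apply (hasFDerivAt_const v p)).const_mul (-Complex.I)
    rw [h.fderiv]; simp
  funext p
  have hs : IsSymmSndFDerivAt ℝ f p := hf.contDiffAt.isSymmSndFDerivAt (by simpa using WithTop.coe_le_coe.2 (le_top : (2 : ℕ∞) ≤ ⊤))
  change -Complex.I * fderiv ℝ (fun q => -Complex.I * fderiv ℝ f q (0, 1)) p (1, 0) =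
    -Complex.I * fderiv ℝ (fun q => -Complex.I * fderiv ℝ f q (1, 0)) p (0, 1)
  rw [key, key, hs]

lemma iterate_D2_D1_comm {f : Fn2} (hf : ContDiff ℝ (⊤ : ℕ∞) f) (b : ℕ) :
    D2^[b] (D1 f) = D1 (D2^[b] f) := by
  induction b with
  | zero => rfl
  | succ b ih =>
    rw [Function.iterate_succ_apply', Function.iterate_succ_apply', ih,
      D1_D2_comm (hf.iterate_D2 b)]

/-- A class of differentiable functions on `ℝ²` closed under `D1` and `D2` consists of smooth
functions. -/
lemma contDiff_of_closed_class {P : Fn2 → Prop} (hd : ∀ f, P f → Differentiable ℝ f)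
    (h1 : ∀ f, P f → P (D1 f)) (h2 : ∀ f, P f → P (D2 f)) {f : Fn2} (hf : P f) :
    ContDiff ℝ (⊤ : ℕ∞) f := by
  rw [contDiff_infty]
  intro n
  induction n generalizing f with
  | zero => exact contDiff_zero.2 (hd f hf).continuous
  | succ n ih =>
    rw [Nat.cast_succ, contDiff_succ_iff_fderiv]
    refine ⟨hd f hf, by simp, ?_⟩
    rw [funext (fderiv_eq_D1_D2 f)]
    exact (contDiff_const.smulRight (contDiff_const.mul (ih (h1 f hf)))).add
      (contDiff_const.smulRight (contDiff_const.mul (ih (h2 f hf))))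

/-- In a class of smooth functions on `ℝ²` closed under `D1` and `D2` whose members decay rapidly,
all derivatives decay rapidly. -/
lemma iteratedFDeriv_decay_of_closed_class {P : Fn2 → Prop} (hd : ∀ f, P f → ContDiff ℝ (⊤ : ℕ∞) f)
    (h1 : ∀ f, P f → P (D1 f)) (h2 : ∀ f, P f → P (D2 f)) (k : ℕ)
    (hk : ∀ f, P f → ∃ C : ℝ, ∀ x, ‖x‖ ^ k * ‖f x‖ ≤ C) (n : ℕ) {f : Fn2} (hf : P f) :
    ∃ C : ℝ, ∀ x, ‖x‖ ^ k * ‖iteratedFDeriv ℝ n f x‖ ≤ C := by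
  induction n generalizing f with
  | zero => simpa using hk f hf
  | succ n ih =>
    obtain ⟨C₁, hC₁⟩ := ih (h1 f hf)
    obtain ⟨C₂, hC₂⟩ := ih (h2 f hf)
    let L₁ : ℂ →L[ℝ] (ℝ × ℝ →L[ℝ] ℂ) :=
      (ContinuousLinearMap.smulRightL ℝ (ℝ × ℝ) ℂ (ContinuousLinearMap.fst ℝ ℝ ℝ)).comp
        (ContinuousLinearMap.mul ℝ ℂ Complex.I)
    let L₂ : ℂ →L[ℝ] (ℝ × ℝ →L[ℝ] ℂ) :=
      (ContinuousLinearMap.smulRightL ℝ (ℝ × ℝ) ℂ (ContinuousLinearMap.snd ℝ ℝ ℝ)).comp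
        (ContinuousLinearMap.mul ℝ ℂ Complex.I)
    have hfd : fderiv ℝ f = (L₁ ∘ D1 f) + (L₂ ∘ D2 f) := by
      funext p
      rw [fderiv_eq_D1_D2]
      rfl
    have c1 : ContDiff ℝ n (D1 f) := (hd _ (h1 f hf)).of_le (by exact_mod_cast le_top)
    have c2 : ContDiff ℝ n (D2 f) := (hd _ (h2 f hf)).of_le (by exact_mod_cast le_top)
    refine ⟨‖L₁‖ * C₁ + ‖L₂‖ * C₂, fun x => ?_⟩
    rw [← norm_iteratedFDeriv_fderiv, hfd,
      iteratedFDeriv_add_apply (L₁.contDiff.comp c1).contDiffAt (L₂.contDiff.comp c2).contDiffAt]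
    calc _ ≤ ‖x‖ ^ k * (‖L₁‖ * ‖iteratedFDeriv ℝ n (D1 f) x‖ +
          ‖L₂‖ * ‖iteratedFDeriv ℝ n (D2 f) x‖) := by
          gcongr
          refine (norm_add_le _ _).trans (add_le_add ?_ ?_)
          · exact L₁.norm_iteratedFDeriv_comp_left c1.contDiffAt le_rfl
          · exact L₂.norm_iteratedFDeriv_comp_left c2.contDiffAt le_rfl
      _ = ‖L₁‖ * (‖x‖ ^ k * ‖iteratedFDeriv ℝ n (D1 f) x‖) +
          ‖L₂‖ * (‖x‖ ^ k * ‖iteratedFDeriv ℝ n (D2 f) x‖) := by ring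
      _ ≤ _ := by gcongr; exacts [hC₁ x, hC₂ x]

lemma norm_le_sqrt_sq_add_sq (p : ℝ × ℝ) : ‖p‖ ≤ Real.sqrt (p.1 ^ 2 + p.2 ^ 2) := by
  rw [Prod.norm_def, Real.norm_eq_abs, Real.norm_eq_abs]
  exact max_le (Real.abs_le_sqrt (by nlinarith [sq_nonneg p.2]))
    (Real.abs_le_sqrt (by nlinarith [sq_nonneg p.1]))

lemma sqrt_sq_add_sq_le (p : ℝ × ℝ) : Real.sqrt (p.1 ^ 2 + p.2 ^ 2) ≤ 2 * ‖p‖ := by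
  have h1 : |p.1| ≤ ‖p‖ := norm_fst_le p
  have h2 : |p.2| ≤ ‖p‖ := norm_snd_le p
  apply Real.sqrt_le_iff.2 ⟨by positivity, ?_⟩
  have h3 := sq_le_sq' (by linarith [norm_nonneg p, abs_nonneg p.1]) h1
  have h4 := sq_le_sq' (by linarith [norm_nonneg p, abs_nonneg p.2]) h2
  rw [sq_abs] at h3 h4
  nlinarith [sq_nonneg ‖p‖]

namespace IsWeightFn

variable {ω : ℝ → ℝ}

/-- A non-quasianalytic weight function grows at most linearly. -/
lemma exists_le_linear (hω : IsWeightFn ω) : ∃ B ≥ 0, ∀ t, 0 ≤ t → ω t ≤ B * (1 + t) := by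
  set J := ∫ t in Set.Ici (1 : ℝ), ω t / t ^ 2 with hJ
  have hJ0 : 0 ≤ J := setIntegral_nonneg measurableSet_Ici fun t ht =>
    div_nonneg (hω.nonneg t (zero_le_one.trans ht)) (sq_nonneg t)
  refine ⟨ω 1 + 4 * J, by linarith [hω.nonneg 1 zero_le_one], fun t ht => ?_⟩
  rcases le_total t 1 with h1 | h1
  · have := hω.mono ht (Set.mem_Ici.2 zero_le_one) h1
    nlinarith [hω.nonneg 1 zero_le_one]
  · have hsub : Set.Icc t (2 * t) ⊆ Set.Ici 1 := fun s hs => h1.trans hs.1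
    have h2 : ∫ _ in Set.Icc t (2 * t), ω t / (2 * t) ^ 2 ≤ ∫ s in Set.Icc t (2 * t), ω s / s ^ 2 := by
      refine setIntegral_mono_on (by simp) (hω.beta.mono_set hsub)
        measurableSet_Icc fun s hs => ?_
      have hs0 : 0 < s := by linarith [hs.1]
      exact div_le_div₀ (hω.nonneg s hs0.le) (hω.mono ht hs0.le hs.1) (by positivity)
        (pow_le_pow_left₀ hs0.le hs.2 2)
    have h3 : ∫ s in Set.Icc t (2 * t), ω s / s ^ 2 ≤ J := by
      refine setIntegral_mono_set hω.beta ?_ hsub.eventuallyLE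
      filter_upwards [self_mem_ae_restrict measurableSet_Ici] with s hs
      exact div_nonneg (hω.nonneg s (zero_le_one.trans hs)) (sq_nonneg s)
    have h4 := h2.trans h3
    have hv : volume.real (Set.Icc t (2 * t)) = t := by
      rw [Real.volume_real_Icc_of_le (by linarith)]; ring
    rw [setIntegral_const, hv, smul_eq_mul] at h4
    have h5 : t * (ω t / (2 * t) ^ 2) = ω t / (4 * t) := by
      have : t ≠ 0 := by linarith
      field_simp; ring
    rw [h5, div_le_iff₀ (by linarith)] at h4
    nlinarith [hω.nonneg 1 zero_le_one]

/-- Approximate subadditivity of the radial weight. -/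
lemma exists_radial_le (hω : IsWeightFn ω) : ∃ A > 0, ∃ B ≥ 0, ∀ p a : ℝ × ℝ,
    ω (Real.sqrt (p.1 ^ 2 + p.2 ^ 2)) ≤
      A * ω (Real.sqrt ((p - a).1 ^ 2 + (p - a).2 ^ 2)) + B * (1 + ‖a‖) := by
  obtain ⟨L, hL, hα⟩ := hω.alpha
  obtain ⟨B, hB, hlin⟩ := hω.exists_le_linear
  refine ⟨L * L, by positivity, L * L * (2 * B) + L * L + L, by positivity, fun p a => ?_⟩
  set e := Real.sqrt ((p - a).1 ^ 2 + (p - a).2 ^ 2)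
  have he : 0 ≤ e := Real.sqrt_nonneg _
  set m := max e ‖a‖
  have hm : 0 ≤ m := he.trans (le_max_left _ _)
  have h1 : Real.sqrt (p.1 ^ 2 + p.2 ^ 2) ≤ 2 * (2 * m) := by
    have h2 : ‖p‖ ≤ ‖p - a‖ + ‖a‖ := by simpa using norm_add_le (p - a) a
    have h3 : ‖p - a‖ ≤ m := (norm_le_sqrt_sq_add_sq (p - a)).trans (le_max_left _ _)
    have h4 : ‖a‖ ≤ m := le_max_right _ _
    linarith [sqrt_sq_add_sq_le p]
  have h2 : ω (Real.sqrt (p.1 ^ 2 + p.2 ^ 2)) ≤ ω (2 * (2 * m)) :=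
    hω.mono (Set.mem_Ici.2 (Real.sqrt_nonneg _)) (Set.mem_Ici.2 (by linarith)) h1
  have h3 := hα (2 * m) (by linarith)
  have h4 : L * ω (2 * m) ≤ L * (L * (ω m + 1)) := by gcongr; exact hα m hm
  have h5 : ω m ≤ ω e + B * (1 + ‖a‖) := by
    rcases max_cases e ‖a‖ with h | h
    · rw [show m = e from h.1]; nlinarith [norm_nonneg a]
    · rw [show m = ‖a‖ from h.1]; linarith [hlin ‖a‖ (norm_nonneg a), hω.nonneg e he]
  have h6 : L * (L * (ω m + 1)) ≤ L * (L * (ω e + B * (1 + ‖a‖) + 1)) := by gcongr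
  have h7 : 0 ≤ L * L * B := by positivity
  nlinarith [norm_nonneg a, mul_nonneg h7 (norm_nonneg a),
    mul_nonneg hL.le (norm_nonneg a), mul_nonneg (mul_nonneg hL.le hL.le) (norm_nonneg a)]

lemma exists_pow_le (hω : IsWeightFn ω) (k : ℕ) : ∃ lam > 0, ∃ C ≥ 0, ∀ p : ℝ × ℝ,
    ‖p‖ ^ k ≤ C * Real.exp (lam * ω (Real.sqrt (p.1 ^ 2 + p.2 ^ 2))) := by
  obtain ⟨a, b, hb, hγ⟩ := hω.gamma
  refine ⟨(k + 1) / b, by positivity, Real.exp (-((k + 1) / b * a)), by positivity, fun p => ?_⟩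
  set e := Real.sqrt (p.1 ^ 2 + p.2 ^ 2)
  have he : 0 ≤ e := Real.sqrt_nonneg _
  rw [← Real.exp_add]
  have h1 : ‖p‖ ^ k ≤ (1 + e) ^ (k + 1) := by
    refine (pow_le_pow_left₀ (norm_nonneg p) (by linarith [norm_le_sqrt_sq_add_sq p]) k).trans
      (pow_le_pow_right₀ (by linarith) (by omega) : (1 + e) ^ k ≤ _)
  refine h1.trans ?_
  rw [← Real.exp_log (show 0 < (1 + e) ^ (k + 1) by positivity), Real.log_pow]
  apply Real.exp_le_exp.2
  have h2 := mul_le_mul_of_nonneg_left (hγ e he) (show 0 ≤ (k + 1) / b by positivity)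
  have h3 : (k + 1) / b * (a + b * Real.log (1 + e)) =
    (k + 1) / b * a + (k + 1) * Real.log (1 + e) := by field_simp
  push_cast
  linarith

end IsWeightFn

/-- Smooth functions all of whose derivatives decay faster than `e^{-λω(|x|)}` for all `λ > 0`. -/
def OmegaDecay (ω : ℝ → ℝ) (h : Fn2) : Prop :=
  ContDiff ℝ (⊤ : ℕ∞) h ∧ ∀ lam > (0 : ℝ), ∀ a b : ℕ, ∃ C : ℝ, ∀ p : ℝ × ℝ,
    Real.exp (lam * ω (Real.sqrt (p.1 ^ 2 + p.2 ^ 2))) * ‖D1^[a] (D2^[b] h) p‖ ≤ C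

namespace OmegaDecay

variable {ω : ℝ → ℝ} {h : Fn2}

lemma D2 (hh : OmegaDecay ω h) : OmegaDecay ω (D2 h) :=
  ⟨hh.1.D2, fun lam hlam a b => by simpa using hh.2 lam hlam a (b + 1)⟩

lemma D1 (hh : OmegaDecay ω h) : OmegaDecay ω (D1 h) :=
  ⟨hh.1.D1, fun lam hlam a b => by
    simpa [iterate_D2_D1_comm hh.1 b] using hh.2 lam hlam (a + 1) b⟩

lemma decay (hh : OmegaDecay ω h) {lam : ℝ} (hlam : 0 < lam) : ∃ C : ℝ, ∀ p : ℝ × ℝ,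
    Real.exp (lam * ω (Real.sqrt (p.1 ^ 2 + p.2 ^ 2))) * ‖h p‖ ≤ C :=
  hh.2 lam hlam 0 0

lemma pow_decay (hω : IsWeightFn ω) (hh : OmegaDecay ω h) (k : ℕ) :
    ∃ C : ℝ, ∀ p : ℝ × ℝ, ‖p‖ ^ k * ‖h p‖ ≤ C := by
  obtain ⟨lam, hlam, C, hC, hp⟩ := hω.exists_pow_le k
  obtain ⟨C', hC'⟩ := hh.decay hlam
  refine ⟨C * C', fun p => ?_⟩
  calc _ ≤ _ := mul_le_mul_of_nonneg_right (hp p) (norm_nonneg _)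
    _ = _ := mul_assoc _ _ _
    _ ≤ _ := mul_le_mul_of_nonneg_left (hC' p) hC

lemma bounded (hω : IsWeightFn ω) (hh : OmegaDecay ω h) : ∃ C ≥ 0, ∀ p : ℝ × ℝ, ‖h p‖ ≤ C := by
  obtain ⟨C, hC⟩ := hh.pow_decay hω 0
  exact ⟨C, le_trans (by positivity) (hC 0), fun p => by simpa using hC p⟩

/-- A function in `OmegaDecay` is a Schwartz function. -/
lemma exists_schwartz (hω : IsWeightFn ω) (hh : OmegaDecay ω h) : ∃ g : 𝓢(ℝ × ℝ, ℂ), ⇑g = h :=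
  ⟨⟨h, hh.1, fun k n => iteratedFDeriv_decay_of_closed_class (P := OmegaDecay ω)
    (fun _ hf => hf.1) (fun _ hf => hf.D1) (fun _ hf => hf.D2) k
    (fun _ hf => hf.pow_decay hω k) n hh⟩, rfl⟩

/-- To be in `OmegaDecay` it suffices to belong to a class of functions closed under `D1` and `D2`
whose members decay faster than `e^{-λω(|x|)}`. -/
lemma of_closed_class {P : Fn2 → Prop} (hd : ∀ f, P f → Differentiable ℝ f)
    (h1 : ∀ f, P f → P (_root_.D1 f)) (h2 : ∀ f, P f → P (_root_.D2 f))
    (hdec : ∀ f, P f → ∀ lam > (0 : ℝ), ∃ C : ℝ, ∀ p : ℝ × ℝ,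
      Real.exp (lam * ω (Real.sqrt (p.1 ^ 2 + p.2 ^ 2))) * ‖f p‖ ≤ C)
    {f : Fn2} (hf : P f) : OmegaDecay ω f := by
  refine ⟨contDiff_of_closed_class hd h1 h2 hf, fun lam hlam a b => hdec _ ?_ lam hlam⟩
  exact Function.Iterate.rec P (Function.Iterate.rec P hf h2 b) h1 a

end OmegaDecay

section HeisenbergOperators

variable {Θ : Type*} [MeasurableSpace Θ]

/-- Superposition of the Heisenberg operators `h ↦ e^{i⟨b, x⟩} h(x - a)` with coefficient `k`. -/
def heisOp (μ : Measure Θ) (a b : Θ → ℝ × ℝ) (k : Θ → ℂ) (h : Fn2) : Fn2 := fun x =>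
  ∫ θ, k θ * Complex.exp (Complex.I * (((b θ).1 * x.1 + (b θ).2 * x.2 : ℝ) : ℂ)) * h (x - a θ) ∂μ

/-- Measurable phase space translations whose size is controlled by `ρ`. -/
structure IsHeisData (a b : Θ → ℝ × ℝ) (ρ : Θ → ℝ) : Prop where
  meas_a : Measurable a
  meas_b : Measurable b
  meas_ρ : Measurable ρ
  norm_a_le : ∀ θ, ‖a θ‖ ≤ ρ θ
  norm_b_le : ∀ θ, ‖b θ‖ ≤ ρ θ

/-- Coefficients that are integrable against every exponential of `ρ`. -/
def ExpIntegrable (μ : Measure Θ) (ρ : Θ → ℝ) (k : Θ → ℂ) : Prop :=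
  AEStronglyMeasurable k μ ∧ ∀ c : ℝ, Integrable (fun θ => Real.exp (c * ρ θ) * ‖k θ‖) μ

variable {μ : Measure Θ} {a b : Θ → ℝ × ℝ} {ρ : Θ → ℝ} {k : Θ → ℂ} {ω : ℝ → ℝ} {h : Fn2}

lemma ExpIntegrable.mul_left (hk : ExpIntegrable μ ρ k) (hρ : Measurable ρ) {m : Θ → ℂ}
    (hm : AEStronglyMeasurable m μ) {c : ℝ} (hmc : ∀ θ, ‖m θ‖ ≤ Real.exp (c * ρ θ)) :
    ExpIntegrable μ ρ (fun θ => m θ * k θ) := by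
  refine ⟨hm.mul hk.1, fun c' => (hk.2 (c' + c)).mono' ?_ (ae_of_all _ fun θ => ?_)⟩
  · exact ((hρ.const_mul c').exp.aestronglyMeasurable).mul (hm.mul hk.1).norm
  · rw [Real.norm_of_nonneg (by positivity), norm_mul, add_mul, Real.exp_add, mul_assoc]
    gcongr
    exact hmc θ

lemma ExpIntegrable.integrable_norm (hk : ExpIntegrable μ ρ k) : Integrable (fun θ => ‖k θ‖) μ := by
  simpa using hk.2 0

namespace IsHeisData

lemma swap (hd : IsHeisData a b ρ) : IsHeisData b (fun θ => -a θ) ρ :=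
  ⟨hd.meas_b, hd.meas_a.neg, hd.meas_ρ, hd.norm_b_le, fun θ => by simpa using hd.norm_a_le θ⟩

lemma expIntegrable_fst_mul (hd : IsHeisData a b ρ) (hk : ExpIntegrable μ ρ k) :
    ExpIntegrable μ ρ (fun θ => (b θ).1 * k θ) := by
  refine hk.mul_left hd.meas_ρ (c := 1)
    (Complex.measurable_ofReal.comp hd.meas_b.fst).aestronglyMeasurable fun θ => ?_
  rw [Complex.norm_real, one_mul]
  linarith [norm_fst_le (b θ), hd.norm_b_le θ, Real.add_one_le_exp (ρ θ)]

lemma expIntegrable_snd_mul (hd : IsHeisData a b ρ) (hk : ExpIntegrable μ ρ k) :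
    ExpIntegrable μ ρ (fun θ => (b θ).2 * k θ) := by
  refine hk.mul_left hd.meas_ρ (c := 1)
    (Complex.measurable_ofReal.comp hd.meas_b.snd).aestronglyMeasurable fun θ => ?_
  rw [Complex.norm_real, one_mul]
  linarith [norm_snd_le (b θ), hd.norm_b_le θ, Real.add_one_le_exp (ρ θ)]

lemma aestronglyMeasurable (hd : IsHeisData a b ρ) (hk : AEStronglyMeasurable k μ)
    (hh : Continuous h) (x : ℝ × ℝ) :
    AEStronglyMeasurable (fun θ => k θ *
      Complex.exp (Complex.I * (((b θ).1 * x.1 + (b θ).2 * x.2 : ℝ) : ℂ)) * h (x - a θ)) μ := by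
  have h1 : Measurable fun θ => h (x - a θ) := hh.measurable.comp (hd.meas_a.const_sub x)
  have h2 : Measurable fun θ =>
      Complex.exp (Complex.I * (((b θ).1 * x.1 + (b θ).2 * x.2 : ℝ) : ℂ)) := by
    have := hd.meas_b
    fun_prop
  exact (hk.mul h2.aestronglyMeasurable).mul h1.aestronglyMeasurable

lemma norm_integrand (k : ℂ) (t : ℝ) (z : ℂ) :
    ‖k * Complex.exp (Complex.I * (t : ℂ)) * z‖ = ‖k‖ * ‖z‖ := by
  rw [norm_mul, norm_mul, mul_comm Complex.I, Complex.norm_exp_ofReal_mul_I, mul_one]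

lemma integrable (hd : IsHeisData a b ρ) (hk : ExpIntegrable μ ρ k)
    (hh : Continuous h) {C : ℝ} (hC : ∀ p, ‖h p‖ ≤ C) (x : ℝ × ℝ) :
    Integrable (fun θ => k θ *
      Complex.exp (Complex.I * (((b θ).1 * x.1 + (b θ).2 * x.2 : ℝ) : ℂ)) * h (x - a θ)) μ := by
  refine (hk.integrable_norm.mul_const C).mono' (hd.aestronglyMeasurable hk.1 hh x)
    (ae_of_all _ fun θ => ?_)
  rw [norm_integrand]
  exact mul_le_mul_of_nonneg_left (hC _) (norm_nonneg _)

end IsHeisData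

lemma hasFDerivAt_heis_integrand (k : ℂ) (a b : ℝ × ℝ) (hh : Differentiable ℝ h) (x : ℝ × ℝ) :
    HasFDerivAt (fun x : ℝ × ℝ =>
        k * Complex.exp (Complex.I * ((b.1 * x.1 + b.2 * x.2 : ℝ) : ℂ)) * h (x - a))
      ((Complex.I * (k * Complex.exp (Complex.I * ((b.1 * x.1 + b.2 * x.2 : ℝ) : ℂ)) *
          (D1 h (x - a) + b.1 * h (x - a)))) • Complex.ofRealCLM.comp (.fst ℝ ℝ ℝ) +
        (Complex.I * (k * Complex.exp (Complex.I * ((b.1 * x.1 + b.2 * x.2 : ℝ) : ℂ)) *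
          (D2 h (x - a) + b.2 * h (x - a)))) • Complex.ofRealCLM.comp (.snd ℝ ℝ ℝ)) x := by
  have h1 : HasFDerivAt (fun x => h (x - a)) (fderiv ℝ h (x - a)) x := by
    have := (hh (x - a)).hasFDerivAt.comp x ((hasFDerivAt_id x).sub_const a)
    rw [ContinuousLinearMap.comp_id] at this
    exact this
  have h2 : HasFDerivAt (fun x : ℝ × ℝ => ((b.1 * x.1 + b.2 * x.2 : ℝ) : ℂ))
      (Complex.ofRealCLM.comp (b.1 • .fst ℝ ℝ ℝ + b.2 • .snd ℝ ℝ ℝ)) x :=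
    (Complex.ofRealCLM.comp (b.1 • .fst ℝ ℝ ℝ + b.2 • .snd ℝ ℝ ℝ)).hasFDerivAt
  refine ((((h2.const_mul Complex.I).cexp).const_mul k).mul h1).congr_fderiv ?_
  ext
  · simp [fderiv_apply_eq_D1_D2]; ring
  · simp [fderiv_apply_eq_D1_D2]; ring

lemma heisOp_hasFDerivAt (hω : IsWeightFn ω) (hd : IsHeisData a b ρ) (hk : ExpIntegrable μ ρ k)
    (hh : OmegaDecay ω h) (x : ℝ × ℝ) :
    HasFDerivAt (heisOp μ a b k h)
      ((Complex.I * (heisOp μ a b k (D1 h) x + heisOp μ a b (fun θ => (b θ).1 * k θ) h x)) •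
          Complex.ofRealCLM.comp (.fst ℝ ℝ ℝ) +
        (Complex.I * (heisOp μ a b k (D2 h) x + heisOp μ a b (fun θ => (b θ).2 * k θ) h x)) •
          Complex.ofRealCLM.comp (.snd ℝ ℝ ℝ)) x := by
  obtain ⟨C₀, hC₀, h0⟩ := hh.bounded hω
  obtain ⟨C₁, hC₁, h1⟩ := hh.D1.bounded hω
  obtain ⟨C₂, hC₂, h2⟩ := hh.D2.bounded hω
  have hc0 := hh.1.continuous
  have hc1 := hh.D1.1.continuous
  have hc2 := hh.D2.1.continuous
  have i1 := fun x => (hd.integrable hk hc1 h1 x)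
  have i1' := fun x => (hd.integrable (hd.expIntegrable_fst_mul hk) hc0 h0 x)
  have i2 := fun x => (hd.integrable hk hc2 h2 x)
  have i2' := fun x => (hd.integrable (hd.expIntegrable_snd_mul hk) hc0 h0 x)
  set E₁ : ℝ × ℝ →L[ℝ] ℂ := Complex.ofRealCLM.comp (.fst ℝ ℝ ℝ)
  set E₂ : ℝ × ℝ →L[ℝ] ℂ := Complex.ofRealCLM.comp (.snd ℝ ℝ ℝ)
  have e1 : ∀ x θ, k θ * Complex.exp (Complex.I * (((b θ).1 * x.1 + (b θ).2 * x.2 : ℝ) : ℂ)) *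
      (D1 h (x - a θ) + (b θ).1 * h (x - a θ)) =
      k θ * Complex.exp (Complex.I * (((b θ).1 * x.1 + (b θ).2 * x.2 : ℝ) : ℂ)) * D1 h (x - a θ) +
      ((b θ).1 * k θ) * Complex.exp (Complex.I * (((b θ).1 * x.1 + (b θ).2 * x.2 : ℝ) : ℂ)) *
        h (x - a θ) := fun x θ => by ring
  have e2 : ∀ x θ, k θ * Complex.exp (Complex.I * (((b θ).1 * x.1 + (b θ).2 * x.2 : ℝ) : ℂ)) *
      (D2 h (x - a θ) + (b θ).2 * h (x - a θ)) =
      k θ * Complex.exp (Complex.I * (((b θ).1 * x.1 + (b θ).2 * x.2 : ℝ) : ℂ)) * D2 h (x - a θ) +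
      ((b θ).2 * k θ) * Complex.exp (Complex.I * (((b θ).1 * x.1 + (b θ).2 * x.2 : ℝ) : ℂ)) *
        h (x - a θ) := fun x θ => by ring
  have j1 : ∀ x, Integrable (fun θ => k θ *
      Complex.exp (Complex.I * (((b θ).1 * x.1 + (b θ).2 * x.2 : ℝ) : ℂ)) *
      (D1 h (x - a θ) + (b θ).1 * h (x - a θ))) μ := fun x => by
    simp_rw [e1]; exact (i1 x).add (i1' x)
  have j2 : ∀ x, Integrable (fun θ => k θ *
      Complex.exp (Complex.I * (((b θ).1 * x.1 + (b θ).2 * x.2 : ℝ) : ℂ)) *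
      (D2 h (x - a θ) + (b θ).2 * h (x - a θ))) μ := fun x => by
    simp_rw [e2]; exact (i2 x).add (i2' x)
  have k1 := ((j1 x).const_mul Complex.I).smul_const E₁
  have k2 := ((j2 x).const_mul Complex.I).smul_const E₂
  have main := hasFDerivAt_integral_of_dominated_of_fderiv_le (𝕜 := ℝ) (μ := μ) (x₀ := x)
    (s := Set.univ)
    (F := fun x θ => k θ * Complex.exp (Complex.I * (((b θ).1 * x.1 + (b θ).2 * x.2 : ℝ) : ℂ)) *
      h (x - a θ))
    (bound := fun θ => (Real.exp (1 * ρ θ) * ‖k θ‖) * ((C₁ + C₀) * ‖E₁‖ + (C₂ + C₀) * ‖E₂‖))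
    Filter.univ_mem (Filter.Eventually.of_forall fun y => hd.aestronglyMeasurable hk.1 hc0 y)
    (hd.integrable hk hc0 h0 x) (k1.add k2).aestronglyMeasurable
    (ae_of_all _ fun θ y _ => ?_) ((hk.2 1).mul_const _)
    (ae_of_all _ fun θ y _ => hasFDerivAt_heis_integrand (k θ) (a θ) (b θ)
      (hh.1.differentiable (by simp)) y)
  · refine main.congr_fderiv ?_
    rw [integral_add k1 k2, integral_smul_const, integral_smul_const, integral_const_mul,
      integral_const_mul]
    simp_rw [e1, e2]
    rw [integral_add (i1 x) (i1' x), integral_add (i2 x) (i2' x)]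
    rfl
  · have hb := hd.norm_b_le θ
    have hρ : ρ θ ≤ Real.exp (1 * ρ θ) := by
      rw [one_mul]; linarith [Real.add_one_le_exp (ρ θ)]
    have hρ1 : 1 ≤ Real.exp (1 * ρ θ) := by
      rw [one_mul]; exact Real.one_le_exp ((norm_nonneg _).trans hb)
    have key : ∀ (c t C : ℝ) (z : ℂ), |c| ≤ ρ θ → ‖z‖ ≤ C → 0 ≤ C →
        ‖Complex.I * (k θ * Complex.exp (Complex.I * (t : ℂ)) * (z + c * h (y - a θ)))‖ ≤
          (Real.exp (1 * ρ θ) * ‖k θ‖) * (C + C₀) := by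
      intro c t C z hc hz hC
      rw [norm_mul, Complex.norm_I, one_mul, IsHeisData.norm_integrand, mul_comm (Real.exp _),
        mul_assoc]
      gcongr
      refine (norm_add_le _ _).trans ?_
      rw [norm_mul, Complex.norm_real, Real.norm_eq_abs, mul_add]
      refine add_le_add (hz.trans (le_mul_of_one_le_left hC hρ1)) ?_
      exact mul_le_mul (hc.trans hρ) (h0 _) (norm_nonneg _) (Real.exp_nonneg _)
    refine (norm_add_le _ _).trans ?_
    rw [norm_smul, norm_smul]
    exact (add_le_add
      (mul_le_mul_of_nonneg_right
        (key _ _ _ _ ((norm_fst_le (b θ)).trans hb) (h1 _) hC₁) (norm_nonneg E₁))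
      (mul_le_mul_of_nonneg_right
        (key _ _ _ _ ((norm_snd_le (b θ)).trans hb) (h2 _) hC₂) (norm_nonneg E₂))).trans_eq
      (by ring)

lemma D1_heisOp (hω : IsWeightFn ω) (hd : IsHeisData a b ρ) (hk : ExpIntegrable μ ρ k)
    (hh : OmegaDecay ω h) : D1 (heisOp μ a b k h) =
      heisOp μ a b k (D1 h) + heisOp μ a b (fun θ => (b θ).1 * k θ) h := by
  funext x
  rw [D1_eq_of_hasFDerivAt (heisOp_hasFDerivAt hω hd hk hh x)]
  simp [← mul_assoc]

lemma D2_heisOp (hω : IsWeightFn ω) (hd : IsHeisData a b ρ) (hk : ExpIntegrable μ ρ k)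
    (hh : OmegaDecay ω h) : D2 (heisOp μ a b k h) =
      heisOp μ a b k (D2 h) + heisOp μ a b (fun θ => (b θ).2 * k θ) h := by
  funext x
  rw [D2_eq_of_hasFDerivAt (heisOp_hasFDerivAt hω hd hk hh x)]
  simp [← mul_assoc]

lemma heisOp_decay (hω : IsWeightFn ω) (hd : IsHeisData a b ρ) (hk : ExpIntegrable μ ρ k)
    (hh : OmegaDecay ω h) {lam : ℝ} (hlam : 0 < lam) : ∃ C : ℝ, ∀ p : ℝ × ℝ,
      Real.exp (lam * ω (Real.sqrt (p.1 ^ 2 + p.2 ^ 2))) * ‖heisOp μ a b k h p‖ ≤ C := by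
  obtain ⟨A, hA, B, hB, hAB⟩ := hω.exists_radial_le
  obtain ⟨C, hC⟩ := hh.decay (mul_pos hlam hA)
  have hC0 : 0 ≤ C := le_trans (by positivity) (hC 0)
  refine ⟨∫ θ, (Real.exp ((lam * B) * ρ θ) * ‖k θ‖) * (Real.exp (lam * B) * C) ∂μ, fun p => ?_⟩
  have hexp : ‖((Real.exp (lam * ω (Real.sqrt (p.1 ^ 2 + p.2 ^ 2))) : ℝ) : ℂ)‖ =
      Real.exp (lam * ω (Real.sqrt (p.1 ^ 2 + p.2 ^ 2))) := by
    rw [Complex.norm_real, Real.norm_of_nonneg (Real.exp_nonneg _)]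
  rw [← hexp, ← norm_mul, heisOp, ← integral_const_mul]
  refine norm_integral_le_of_norm_le ((hk.2 _).mul_const _) (ae_of_all _ fun θ => ?_)
  rw [norm_mul, hexp, IsHeisData.norm_integrand]
  have h1 : Real.exp (lam * ω (Real.sqrt (p.1 ^ 2 + p.2 ^ 2))) ≤
      Real.exp (lam * B * ρ θ) * Real.exp (lam * B) *
        Real.exp (lam * A * ω (Real.sqrt ((p - a θ).1 ^ 2 + (p - a θ).2 ^ 2))) := by
    rw [← Real.exp_add, ← Real.exp_add]
    apply Real.exp_le_exp.2
    have h2 := mul_le_mul_of_nonneg_left (hAB p (a θ)) hlam.le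
    have h3 := mul_le_mul_of_nonneg_left (hd.norm_a_le θ) (mul_nonneg hlam.le hB)
    linarith
  calc _ ≤ (Real.exp (lam * B * ρ θ) * Real.exp (lam * B) *
        Real.exp (lam * A * ω (Real.sqrt ((p - a θ).1 ^ 2 + (p - a θ).2 ^ 2)))) *
          (‖k θ‖ * ‖h (p - a θ)‖) := by gcongr
    _ = Real.exp (lam * B * ρ θ) * ‖k θ‖ * (Real.exp (lam * B) *
        (Real.exp (lam * A * ω (Real.sqrt ((p - a θ).1 ^ 2 + (p - a θ).2 ^ 2))) *
          ‖h (p - a θ)‖)) := by ring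
    _ ≤ _ := by gcongr; exact hC _

/-- Sums of functions `heisOp μ a b k h` with `h` in `OmegaDecay ω`. -/
inductive HeisSum (ω : ℝ → ℝ) (μ : Measure Θ) (a b : Θ → ℝ × ℝ) (ρ : Θ → ℝ) : Fn2 → Prop
  | of (k : Θ → ℂ) (h : Fn2) : ExpIntegrable μ ρ k → OmegaDecay ω h →
      HeisSum ω μ a b ρ (heisOp μ a b k h)
  | add (f g : Fn2) : HeisSum ω μ a b ρ f → HeisSum ω μ a b ρ g → HeisSum ω μ a b ρ (f + g)

lemma HeisSum.differentiable (hω : IsWeightFn ω) (hd : IsHeisData a b ρ) {f : Fn2}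
    (hf : HeisSum ω μ a b ρ f) : Differentiable ℝ f := by
  induction hf with
  | of k h hk hh => exact fun x => (heisOp_hasFDerivAt hω hd hk hh x).differentiableAt
  | add f g _ _ hf hg => exact hf.add hg

lemma D1_add {f g : Fn2} (hf : Differentiable ℝ f) (hg : Differentiable ℝ g) :
    D1 (f + g) = D1 f + D1 g := by
  funext p; simp [D1, fderiv_add (hf p) (hg p), mul_add]

lemma D2_add {f g : Fn2} (hf : Differentiable ℝ f) (hg : Differentiable ℝ g) :
    D2 (f + g) = D2 f + D2 g := by
  funext p; simp [D2, fderiv_add (hf p) (hg p), mul_add]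

lemma HeisSum.D1 (hω : IsWeightFn ω) (hd : IsHeisData a b ρ) {f : Fn2}
    (hf : HeisSum ω μ a b ρ f) : HeisSum ω μ a b ρ (D1 f) := by
  induction hf with
  | of k h hk hh =>
    rw [D1_heisOp hω hd hk hh]
    exact .add _ _ (.of _ _ hk hh.D1) (.of _ _ (hd.expIntegrable_fst_mul hk) hh)
  | add f g hf hg hf' hg' =>
    rw [D1_add (hf.differentiable hω hd) (hg.differentiable hω hd)]
    exact .add _ _ hf' hg'

lemma HeisSum.D2 (hω : IsWeightFn ω) (hd : IsHeisData a b ρ) {f : Fn2}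
    (hf : HeisSum ω μ a b ρ f) : HeisSum ω μ a b ρ (D2 f) := by
  induction hf with
  | of k h hk hh =>
    rw [D2_heisOp hω hd hk hh]
    exact .add _ _ (.of _ _ hk hh.D2) (.of _ _ (hd.expIntegrable_snd_mul hk) hh)
  | add f g hf hg hf' hg' =>
    rw [D2_add (hf.differentiable hω hd) (hg.differentiable hω hd)]
    exact .add _ _ hf' hg'

lemma HeisSum.decay (hω : IsWeightFn ω) (hd : IsHeisData a b ρ) {f : Fn2}
    (hf : HeisSum ω μ a b ρ f) {lam : ℝ} (hlam : 0 < lam) : ∃ C : ℝ, ∀ p : ℝ × ℝ,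
      Real.exp (lam * ω (Real.sqrt (p.1 ^ 2 + p.2 ^ 2))) * ‖f p‖ ≤ C := by
  induction hf with
  | of k h hk hh => exact heisOp_decay hω hd hk hh hlam
  | add f g _ _ hf hg =>
    obtain ⟨C, hC⟩ := hf
    obtain ⟨C', hC'⟩ := hg
    refine ⟨C + C', fun p => le_trans ?_ (add_le_add (hC p) (hC' p))⟩
    rw [← mul_add]
    gcongr
    exact norm_add_le _ _

lemma OmegaDecay.heisOp (hω : IsWeightFn ω) (hd : IsHeisData a b ρ) (hk : ExpIntegrable μ ρ k)
    (hh : OmegaDecay ω h) : OmegaDecay ω (heisOp μ a b k h) :=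
  OmegaDecay.of_closed_class (P := HeisSum ω μ a b ρ) (fun _ hf => hf.differentiable hω hd)
    (fun _ hf => hf.D1 hω hd) (fun _ hf => hf.D2 hω hd) (fun _ hf _ hl => hf.decay hω hd hl)
    (.of k h hk hh)

/-- The Fourier transform intertwines superpositions of Heisenberg operators. -/
lemma FT2_heisOp [SFinite μ] (hd : IsHeisData a b ρ) (hk : ExpIntegrable μ ρ k)
    (hc : Continuous h) (hi : Integrable h) :
    FT2 (heisOp μ a b k h) = heisOp μ b (fun θ => -a θ) (fun θ => Complex.exp (Complex.I *
      (((a θ).1 * (b θ).1 + (a θ).2 * (b θ).2 : ℝ) : ℂ)) * k θ) (FT2 h) := by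
  funext ξ
  simp only [FT2, heisOp, ← integral_const_mul]
  rw [integral_integral_swap]
  · congr 1
    funext θ
    rw [← integral_sub_right_eq_self _ (-a θ)]
    congr 1
    funext x
    have : x - -a θ - a θ = x := by simp
    rw [this]
    simp only [← mul_assoc]
    congr 1
    rw [mul_comm _ (k θ), mul_assoc (k θ), mul_comm _ (k θ), mul_assoc (k θ), ← Complex.exp_add, ← Complex.exp_add,
      mul_assoc (k θ), ← Complex.exp_add]
    congr 2
    simp
    ring
  · have ha := hd.meas_a
    have hb := hd.meas_b
    have hk' : AEStronglyMeasurable (fun z : (ℝ × ℝ) × Θ => k z.2)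
        ((volume : Measure (ℝ × ℝ)).prod μ) := hk.1.comp_snd
    have hm : AEStronglyMeasurable (fun z : (ℝ × ℝ) × Θ =>
        Complex.exp (-Complex.I * ((z.1.1 * ξ.1 + z.1.2 * ξ.2 : ℝ) : ℂ)) * (k z.2 *
          Complex.exp (Complex.I * (((b z.2).1 * z.1.1 + (b z.2).2 * z.1.2 : ℝ) : ℂ)) *
            h (z.1 - a z.2))) ((volume : Measure (ℝ × ℝ)).prod μ) := by
      have h1 : Measurable (fun z : (ℝ × ℝ) × Θ => h (z.1 - a z.2)) :=
        hc.measurable.comp (by fun_prop)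
      have h2 : Measurable (fun z : (ℝ × ℝ) × Θ =>
        Complex.exp (-Complex.I * ((z.1.1 * ξ.1 + z.1.2 * ξ.2 : ℝ) : ℂ))) := by fun_prop
      have h3 : Measurable (fun z : (ℝ × ℝ) × Θ =>
        Complex.exp (Complex.I * (((b z.2).1 * z.1.1 + (b z.2).2 * z.1.2 : ℝ) : ℂ))) := by
          fun_prop
      exact h2.aestronglyMeasurable.mul
        ((hk'.mul h3.aestronglyMeasurable).mul h1.aestronglyMeasurable)
    have hn : ∀ (x : ℝ × ℝ) (θ : Θ),
        ‖Complex.exp (-Complex.I * ((x.1 * ξ.1 + x.2 * ξ.2 : ℝ) : ℂ)) * (k θ *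
          Complex.exp (Complex.I * (((b θ).1 * x.1 + (b θ).2 * x.2 : ℝ) : ℂ)) *
            h (x - a θ))‖ = ‖k θ‖ * ‖h (x - a θ)‖ := fun x θ => by
      rw [norm_mul, IsHeisData.norm_integrand, Complex.norm_exp]
      simp
    refine (integrable_prod_iff' hm).2 ⟨ae_of_all _ fun θ => ?_, ?_⟩
    · refine Integrable.mono' ((hi.norm.comp_sub_right (a θ)).const_mul ‖k θ‖) ?_
        (ae_of_all _ fun x => (hn x θ).le)
      have h1 : Continuous (fun x : ℝ × ℝ => h (x - a θ)) := Continuous.comp hc (by fun_prop)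
      have h2 : Continuous (fun x : ℝ × ℝ =>
        Complex.exp (-Complex.I * ((x.1 * ξ.1 + x.2 * ξ.2 : ℝ) : ℂ))) := by fun_prop
      have h3 : Continuous (fun x : ℝ × ℝ => k θ *
        Complex.exp (Complex.I * (((b θ).1 * x.1 + (b θ).2 * x.2 : ℝ) : ℂ))) := by fun_prop
      exact h2.aestronglyMeasurable.mul (h3.aestronglyMeasurable.mul h1.aestronglyMeasurable)
    · simp only [hn]
      have : ∀ θ, ∫ x, ‖k θ‖ * ‖h (x - a θ)‖ = ‖k θ‖ * ∫ x, ‖h x‖ := fun θ => by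
        rw [integral_const_mul, integral_sub_right_eq_self (fun x => ‖h x‖)]
      simp only [this]
      exact hk.integrable_norm.mul_const _

end HeisenbergOperators

lemma contDiff_FT2 (f : 𝓢(ℝ × ℝ, ℂ)) : ContDiff ℝ (⊤ : ℕ∞) (FT2 f) := by
  let L : (ℝ × ℝ) →L[ℝ] (ℝ × ℝ) →L[ℝ] ℝ :=
    (2 * π)⁻¹ • ((ContinuousLinearMap.fst ℝ ℝ ℝ).smulRight (ContinuousLinearMap.fst ℝ ℝ ℝ) +
      (ContinuousLinearMap.snd ℝ ℝ ℝ).smulRight (ContinuousLinearMap.snd ℝ ℝ ℝ))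
  have key : FT2 f = VectorFourier.fourierIntegral Real.fourierChar volume L.toLinearMap₁₂ f := by
    funext ξ
    refine integral_congr_ae (ae_of_all _ fun p => ?_)
    have hL : L p ξ = (2 * π)⁻¹ * (p.1 * ξ.1 + p.2 * ξ.2) := by
      simp [L, mul_add]
    have hπ : (2 * π : ℝ) ≠ 0 := by positivity
    have h2 : L.toLinearMap₁₂ p ξ = L p ξ := rfl
    simp only [Circle.smul_def, h2, hL, Real.fourierChar_apply, smul_eq_mul]
    congr 2
    have h3 : 2 * π * -((2 * π)⁻¹ * (p.1 * ξ.1 + p.2 * ξ.2)) = -(p.1 * ξ.1 + p.2 * ξ.2) := by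
      field_simp
    rw [h3]
    push_cast
    ring
  rw [key]
  exact VectorFourier.contDiff_fourierIntegral L fun n _ => f.integrable_pow_mul volume n

lemma SOmega2.omegaDecay {ω : ℝ → ℝ} {f : 𝓢(ℝ × ℝ, ℂ)} (hf : SOmega2 ω f) :
    OmegaDecay ω f :=
  ⟨f.smooth', hf.1⟩

lemma SOmega2.omegaDecay_FT2 {ω : ℝ → ℝ} {f : 𝓢(ℝ × ℝ, ℂ)} (hf : SOmega2 ω f) :
    OmegaDecay ω (FT2 f) :=
  ⟨contDiff_FT2 f, hf.2⟩

namespace SchwartzMap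

open LineDeriv

lemma exists_coe_eq_D1 (f : 𝓢(ℝ × ℝ, ℂ)) : ∃ g : 𝓢(ℝ × ℝ, ℂ), ⇑g = D1 f :=
  ⟨(-Complex.I) • ∂_{((1, 0) : ℝ × ℝ)} f, by
    funext p; simp [D1, lineDerivOp_apply_eq_fderiv]⟩

lemma exists_coe_eq_D2 (f : 𝓢(ℝ × ℝ, ℂ)) : ∃ g : 𝓢(ℝ × ℝ, ℂ), ⇑g = D2 f :=
  ⟨(-Complex.I) • ∂_{((0, 1) : ℝ × ℝ)} f, by
    funext p; simp [D2, lineDerivOp_apply_eq_fderiv]⟩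

lemma exists_coe_eq_M1 (f : 𝓢(ℝ × ℝ, ℂ)) : ∃ g : 𝓢(ℝ × ℝ, ℂ), ⇑g = M1 f := by
  have h : Function.HasTemperateGrowth (fun p : ℝ × ℝ => (p.1 : ℂ)) :=
    (Complex.ofRealCLM.comp (ContinuousLinearMap.fst ℝ ℝ ℝ)).hasTemperateGrowth
  exact ⟨smulLeftCLM ℂ (fun p : ℝ × ℝ => (p.1 : ℂ)) f, by
    funext p; simp [M1, smulLeftCLM_apply_apply h]⟩

lemma exists_coe_eq_M2 (f : 𝓢(ℝ × ℝ, ℂ)) : ∃ g : 𝓢(ℝ × ℝ, ℂ), ⇑g = M2 f := by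
  have h : Function.HasTemperateGrowth (fun p : ℝ × ℝ => (p.2 : ℂ)) :=
    (Complex.ofRealCLM.comp (ContinuousLinearMap.snd ℝ ℝ ℝ)).hasTemperateGrowth
  exact ⟨smulLeftCLM ℂ (fun p : ℝ × ℝ => (p.2 : ℂ)) f, by
    funext p; simp [M2, smulLeftCLM_apply_apply h]⟩

lemma integrable_mul (f g : 𝓢(ℝ × ℝ, ℂ)) : Integrable (fun p => f p * g p) := by
  obtain ⟨C, hC⟩ := f.decay 0 0
  refine g.integrable.bdd_mul (c := C) f.continuous.aestronglyMeasurable (ae_of_all _ fun p => ?_)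
  simpa using hC.2 p

lemma integral_D1_mul (f g : 𝓢(ℝ × ℝ, ℂ)) : ∫ p, D1 f p * g p = -∫ p, f p * D1 g p := by
  have h := integral_mul_lineDerivOp_right_eq_neg_left (μ := volume) f g ((1, 0) : ℝ × ℝ)
  simp only [lineDerivOp_apply_eq_fderiv] at h
  simp only [D1, mul_left_comm _ (-Complex.I), mul_assoc (-Complex.I), integral_const_mul, h]
  ring

lemma integral_D2_mul (f g : 𝓢(ℝ × ℝ, ℂ)) : ∫ p, D2 f p * g p = -∫ p, f p * D2 g p := by
  have h := integral_mul_lineDerivOp_right_eq_neg_left (μ := volume) f g ((0, 1) : ℝ × ℝ)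
  simp only [lineDerivOp_apply_eq_fderiv] at h
  simp only [D2, mul_left_comm _ (-Complex.I), mul_assoc (-Complex.I), integral_const_mul, h]
  ring

lemma exists_coe_eq_D1_add_M2 (c : ℂ) (f : 𝓢(ℝ × ℝ, ℂ)) :
    ∃ g : 𝓢(ℝ × ℝ, ℂ), ⇑g = (D1 + c • M2) f := by
  obtain ⟨g₁, h₁⟩ := f.exists_coe_eq_D1
  obtain ⟨g₂, h₂⟩ := f.exists_coe_eq_M2
  exact ⟨g₁ + c • g₂, by funext p; simp [h₁, h₂]⟩

lemma exists_coe_eq_D2_add_M1 (c : ℂ) (f : 𝓢(ℝ × ℝ, ℂ)) :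
    ∃ g : 𝓢(ℝ × ℝ, ℂ), ⇑g = (D2 + c • M1) f := by
  obtain ⟨g₁, h₁⟩ := f.exists_coe_eq_D2
  obtain ⟨g₂, h₂⟩ := f.exists_coe_eq_M1
  exact ⟨g₁ + c • g₂, by funext p; simp [h₁, h₂]⟩

lemma integral_D1_add_M2_mul (c : ℂ) (f g : 𝓢(ℝ × ℝ, ℂ)) :
    ∫ p, (D1 + c • M2) f p * g p = -∫ p, f p * (D1 + (-c) • M2) g p := by
  obtain ⟨f₁, hf₁⟩ := f.exists_coe_eq_D1
  obtain ⟨f₂, hf₂⟩ := f.exists_coe_eq_M2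
  obtain ⟨g₁, hg₁⟩ := g.exists_coe_eq_D1
  obtain ⟨g₂, hg₂⟩ := g.exists_coe_eq_M2
  have h := integral_D1_mul f g
  simp only [Pi.add_apply, Pi.smul_apply, ← hf₁, ← hf₂, ← hg₁, ← hg₂, smul_eq_mul, add_mul,
    mul_add, mul_assoc, mul_left_comm _ (-c)] at h ⊢
  rw [integral_add (integrable_mul f₁ g) ((integrable_mul f₂ g).const_mul c),
    integral_add (integrable_mul f g₁) ((integrable_mul f g₂).const_mul (-c)),
    integral_const_mul, integral_const_mul, h]
  have h2 : ∫ p, f₂ p * g p = ∫ p, f p * g₂ p := by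
    simp only [hf₂, hg₂, M2]
    congr 1; funext p; ring
  rw [h2]; ring

lemma integral_D2_add_M1_mul (c : ℂ) (f g : 𝓢(ℝ × ℝ, ℂ)) :
    ∫ p, (D2 + c • M1) f p * g p = -∫ p, f p * (D2 + (-c) • M1) g p := by
  obtain ⟨f₁, hf₁⟩ := f.exists_coe_eq_D2
  obtain ⟨f₂, hf₂⟩ := f.exists_coe_eq_M1
  obtain ⟨g₁, hg₁⟩ := g.exists_coe_eq_D2
  obtain ⟨g₂, hg₂⟩ := g.exists_coe_eq_M1
  have h := integral_D2_mul f g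
  simp only [Pi.add_apply, Pi.smul_apply, ← hf₁, ← hf₂, ← hg₁, ← hg₂, smul_eq_mul, add_mul,
    mul_add, mul_assoc, mul_left_comm _ (-c)] at h ⊢
  rw [integral_add (integrable_mul f₁ g) ((integrable_mul f₂ g).const_mul c),
    integral_add (integrable_mul f g₁) ((integrable_mul f g₂).const_mul (-c)),
    integral_const_mul, integral_const_mul, h]
  have h2 : ∫ p, f₂ p * g p = ∫ p, f p * g₂ p := by
    simp only [hf₂, hg₂, M1]
    congr 1; funext p; ring
  rw [h2]; ring

lemma integral_D1_add_M2_sq_mul (c : ℂ) (f g : 𝓢(ℝ × ℝ, ℂ)) :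
    ∫ p, (D1 + c • M2) ((D1 + c • M2) f) p * g p =
      ∫ p, f p * (D1 + (-c) • M2) ((D1 + (-c) • M2) g) p := by
  obtain ⟨f₁, hf₁⟩ := f.exists_coe_eq_D1_add_M2 c
  obtain ⟨g₁, hg₁⟩ := g.exists_coe_eq_D1_add_M2 (-c)
  rw [← hf₁, integral_D1_add_M2_mul, hf₁, ← hg₁, integral_D1_add_M2_mul, neg_neg]

lemma integral_D2_add_M1_sq_mul (c : ℂ) (f g : 𝓢(ℝ × ℝ, ℂ)) :
    ∫ p, (D2 + c • M1) ((D2 + c • M1) f) p * g p =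
      ∫ p, f p * (D2 + (-c) • M1) ((D2 + (-c) • M1) g) p := by
  obtain ⟨f₁, hf₁⟩ := f.exists_coe_eq_D2_add_M1 c
  obtain ⟨g₁, hg₁⟩ := g.exists_coe_eq_D2_add_M1 (-c)
  rw [← hf₁, integral_D2_add_M1_mul, hf₁, ← hg₁, integral_D2_add_M1_mul, neg_neg]

end SchwartzMap

/-- The twisted Laplacian with parameter `s`: `s = 1` gives `Ltwist`, `s = -1` gives `LtwistT`. -/
def twistedLaplacian (s : ℝ) : Fn2 → Fn2 := fun f =>
  (D1 + (-(s / 2 : ℂ)) • M2) ((D1 + (-(s / 2 : ℂ)) • M2) f) +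
    (D2 + ((s / 2 : ℂ)) • M1) ((D2 + ((s / 2 : ℂ)) • M1) f)

lemma LtwistT_eq : LtwistT = twistedLaplacian (-1) := by
  funext f; simp [LtwistT, twistedLaplacian, sub_eq_add_neg, neg_div]

/-- The formal transpose of the twisted Laplacian. -/
lemma integral_twistedLaplacian_mul (s : ℝ) (f g : 𝓢(ℝ × ℝ, ℂ)) :
    ∫ p, twistedLaplacian s f p * g p = ∫ p, f p * twistedLaplacian (-s) g p := by
  obtain ⟨f₁, hf₁⟩ := f.exists_coe_eq_D1_add_M2 (-(s / 2 : ℂ))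
  obtain ⟨f₂, hf₂⟩ := f.exists_coe_eq_D2_add_M1 (s / 2 : ℂ)
  obtain ⟨g₁, hg₁⟩ := g.exists_coe_eq_D1_add_M2 (-(-s / 2 : ℂ))
  obtain ⟨g₂, hg₂⟩ := g.exists_coe_eq_D2_add_M1 (-s / 2 : ℂ)
  obtain ⟨f₁', hf₁'⟩ := f₁.exists_coe_eq_D1_add_M2 (-(s / 2 : ℂ))
  obtain ⟨f₂', hf₂'⟩ := f₂.exists_coe_eq_D2_add_M1 (s / 2 : ℂ)
  obtain ⟨g₁', hg₁'⟩ := g₁.exists_coe_eq_D1_add_M2 (-(-s / 2 : ℂ))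
  obtain ⟨g₂', hg₂'⟩ := g₂.exists_coe_eq_D2_add_M1 (-s / 2 : ℂ)
  have h1 : ∫ p, f₁' p * g p = ∫ p, f p * g₁' p := by
    rw [hf₁', hf₁, SchwartzMap.integral_D1_add_M2_sq_mul, hg₁', hg₁, neg_div]
  have h2 : ∫ p, f₂' p * g p = ∫ p, f p * g₂' p := by
    rw [hf₂', hf₂, SchwartzMap.integral_D2_add_M1_sq_mul, hg₂', hg₂, neg_div]
  simp only [twistedLaplacian, Complex.ofReal_neg, ← hf₁, ← hf₂, ← hg₁, ← hg₂, ← hf₁', ← hf₂',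
    ← hg₁', ← hg₂', Pi.add_apply, add_mul, mul_add]
  rw [integral_add (f₁'.integrable_mul g) (f₂'.integrable_mul g),
    integral_add (f.integrable_mul g₁') (f.integrable_mul g₂'), h1, h2]

/-- The Gaussian `e^{-|w|²}` on `ℝ²`. -/
def gauss (w : ℝ × ℝ) : ℝ := Real.exp (-(w.1 ^ 2 + w.2 ^ 2))

lemma gauss_eq_mul (w : ℝ × ℝ) : gauss w = Real.exp (-1 * w.1 ^ 2) * Real.exp (-1 * w.2 ^ 2) := by
  rw [gauss, ← Real.exp_add]; congr 1; ring

lemma gauss_pos (w : ℝ × ℝ) : 0 < gauss w := Real.exp_pos _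

lemma continuous_gauss : Continuous gauss := by unfold gauss; fun_prop

lemma integral_gauss : ∫ w, gauss w = π := by
  simp only [gauss_eq_mul]
  rw [Measure.volume_eq_prod, integral_prod_mul (fun x : ℝ => Real.exp (-1 * x ^ 2))
    (fun x : ℝ => Real.exp (-1 * x ^ 2)), integral_gaussian, div_one,
    Real.mul_self_sqrt Real.pi_pos.le]

lemma integrable_exp_norm_mul_gauss (c : ℝ) :
    Integrable (fun w : ℝ × ℝ => Real.exp (c * ‖w‖) * gauss w) := by
  have h1 : Integrable (fun x : ℝ => Real.exp (-(1 / 2) * x ^ 2)) :=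
    integrable_exp_neg_mul_sq (by norm_num)
  have h2 := (h1.mul_prod h1).const_mul (Real.exp (c ^ 2))
  rw [← Measure.volume_eq_prod] at h2
  refine h2.mono' ?_ (ae_of_all _ fun w => ?_)
  · have := continuous_gauss
    exact Continuous.aestronglyMeasurable (by fun_prop)
  · rw [Real.norm_of_nonneg (by have := gauss_pos w; positivity), gauss, ← Real.exp_add,
      ← Real.exp_add, ← Real.exp_add]
    apply Real.exp_le_exp.2
    have h3 : ‖w‖ ^ 2 ≤ w.1 ^ 2 + w.2 ^ 2 := by
      have := norm_le_sqrt_sq_add_sq w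
      have h4 := Real.sq_sqrt (show 0 ≤ w.1 ^ 2 + w.2 ^ 2 by positivity)
      rw [← h4]
      gcongr
    nlinarith [sq_nonneg (c - ‖w‖)]

/-- Parameter measure for the Green operator of the twisted Laplacian. -/
def greenMeasure : Measure (ℝ × ℝ × ℝ) := (volume.restrict (Set.Ioc 0 (π / 2))).prod volume

instance : SFinite greenMeasure := by unfold greenMeasure; infer_instance

/-- Space translations of the Green operator. -/
def greenShift (θ : ℝ × ℝ × ℝ) : ℝ × ℝ := (2 * √(Real.sin θ.1)) • θ.2

/-- Frequency translations of the Green operator. -/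
def greenFreq (s : ℝ) (θ : ℝ × ℝ × ℝ) : ℝ × ℝ := (√(Real.sin θ.1) * s) • (-θ.2.2, θ.2.1)

/-- Density of the Green operator. -/
def greenDensity (θ : ℝ × ℝ × ℝ) : ℂ := (π : ℂ)⁻¹ * gauss θ.2

lemma isHeisData_green {s : ℝ} (hs : |s| ≤ 1) :
    IsHeisData greenShift (greenFreq s) (fun θ => 2 * ‖θ.2‖) := by
  have h1 : ∀ t, √(Real.sin t) ≤ 1 := fun t => Real.sqrt_le_one.2 (Real.sin_le_one t)
  refine ⟨?_, ?_, ?_, fun θ => ?_, fun θ => ?_⟩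
  · unfold greenShift; fun_prop
  · unfold greenFreq; fun_prop
  · fun_prop
  · rw [greenShift, norm_smul, norm_mul, Real.norm_of_nonneg (Real.sqrt_nonneg _), Real.norm_two]
    nlinarith [h1 θ.1, norm_nonneg θ.2]
  · have h2 : ‖((-θ.2.2, θ.2.1) : ℝ × ℝ)‖ = ‖θ.2‖ := by
      rw [Prod.norm_def, Prod.norm_def, norm_neg, max_comm]
    rw [greenFreq, norm_smul, norm_mul, Real.norm_of_nonneg (Real.sqrt_nonneg _), h2,
      Real.norm_eq_abs]
    have h3 : √(Real.sin θ.1) * |s| ≤ 1 := mul_le_one₀ (h1 _) (abs_nonneg _) hs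
    nlinarith [norm_nonneg θ.2]

lemma expIntegrable_green : ExpIntegrable greenMeasure (fun θ => 2 * ‖θ.2‖) greenDensity := by
  have hg : Continuous greenDensity := by
    have := continuous_gauss
    unfold greenDensity; fun_prop
  refine ⟨hg.aestronglyMeasurable, fun c => ?_⟩
  have h := ((integrable_exp_norm_mul_gauss (c * 2)).const_mul π⁻¹).comp_snd
    (volume.restrict (Set.Ioc 0 (π / 2)))
  refine h.congr (ae_of_all _ fun θ => ?_)
  simp only [greenDensity]
  rw [norm_mul, norm_inv, Complex.norm_real, Complex.norm_real, Real.norm_of_nonneg Real.pi_pos.le,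
    Real.norm_of_nonneg (gauss_pos _).le]
  ring_nf

/-- The Green operator of the twisted Laplacian. -/
def green (s : ℝ) (f : Fn2) : Fn2 := heisOp greenMeasure greenShift (greenFreq s) greenDensity f

lemma SOmega2.exists_green {ω : ℝ → ℝ} (hω : IsWeightFn ω) {s : ℝ} (hs : |s| ≤ 1)
    {f : 𝓢(ℝ × ℝ, ℂ)} (hf : SOmega2 ω f) : ∃ g : 𝓢(ℝ × ℝ, ℂ), SOmega2 ω g ∧ ⇑g = green s f := by
  have h1 : OmegaDecay ω (green s f) :=
    OmegaDecay.heisOp hω (isHeisData_green hs) expIntegrable_green hf.omegaDecay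
  obtain ⟨g, hg⟩ := h1.exists_schwartz hω
  refine ⟨g, ⟨hg ▸ h1.2, ?_⟩, hg⟩
  have hd := isHeisData_green hs
  have h2 : OmegaDecay ω (FT2 g) := by
    rw [hg, green, FT2_heisOp hd expIntegrable_green f.continuous f.integrable]
    refine OmegaDecay.heisOp hω hd.swap (expIntegrable_green.mul_left hd.meas_ρ (c := 0) ?_ ?_)
      hf.omegaDecay_FT2
    · have ha := hd.meas_a
      have hb := hd.meas_b
      exact Measurable.aestronglyMeasurable (by fun_prop)
    · intro θ
      rw [mul_comm Complex.I, Complex.norm_exp_ofReal_mul_I]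
      simp
  exact h2.2

section GaussMoment

/-- Integrand of `gaussMoment`. -/
def gaussMomentFun (s : ℝ) (x : ℝ × ℝ) (i j : ℕ) (h : Fn2) (r : ℝ) (w : ℝ × ℝ) : ℂ :=
  gauss w * ((w.1 : ℂ) ^ i * (w.2 : ℂ) ^ j *
    (Complex.exp (Complex.I * ((r * s * (x.2 * w.1 - x.1 * w.2) : ℝ) : ℂ)) *
      h (x - (2 * r) • w)))

/-- Gaussian moments of the Heisenberg translates of a function. -/
def gaussMoment (s : ℝ) (x : ℝ × ℝ) (i j : ℕ) (h : Fn2) (r : ℝ) : ℂ :=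
  ∫ w, gaussMomentFun s x i j h r w

variable {s r : ℝ} {x : ℝ × ℝ} {i j : ℕ} {h : Fn2} {ω : ℝ → ℝ}

lemma continuous_gaussMomentFun (hh : Continuous h) : Continuous (gaussMomentFun s x i j h r) := by
  have h1 := continuous_gauss
  have h2 : Continuous fun w : ℝ × ℝ => h (x - (2 * r) • w) := hh.comp (by fun_prop)
  refine (Complex.continuous_ofReal.comp h1).mul (Continuous.mul ?_ (Continuous.mul ?_ h2))
  all_goals fun_prop

lemma norm_gaussMomentFun_le {C : ℝ} (hC : ∀ p, ‖h p‖ ≤ C) (w : ℝ × ℝ) :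
    ‖gaussMomentFun s x i j h r w‖ ≤ (i + j).factorial * C * (Real.exp (1 * ‖w‖) * gauss w) := by
  have h1 : ‖(w.1 : ℂ) ^ i * (w.2 : ℂ) ^ j‖ ≤ (i + j).factorial * Real.exp (1 * ‖w‖) := by
    have h2 := Real.pow_div_factorial_le_exp ‖w‖ (norm_nonneg w) (i + j)
    rw [div_le_iff₀ (by positivity)] at h2
    rw [norm_mul, norm_pow, norm_pow, Complex.norm_real, Complex.norm_real, one_mul]
    calc _ ≤ ‖w‖ ^ i * ‖w‖ ^ j := by
          gcongr
          · exact norm_fst_le w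
          · exact norm_snd_le w
      _ ≤ _ := by rw [← pow_add, mul_comm (_ : ℝ) (Real.exp _)]; exact h2
  rw [gaussMomentFun, norm_mul, Complex.norm_real, Real.norm_of_nonneg (gauss_pos w).le, norm_mul,
    norm_mul (Complex.exp _), mul_comm Complex.I, Complex.norm_exp_ofReal_mul_I, one_mul]
  calc _ ≤ gauss w * (((i + j).factorial * Real.exp (1 * ‖w‖)) * C) := by
        have := gauss_pos w
        gcongr
        exact hC _
    _ = _ := by ring

lemma OmegaDecay.exists_norm_gaussMomentFun_le (hω : IsWeightFn ω) (hh : OmegaDecay ω h)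
    (s : ℝ) (x : ℝ × ℝ) (i j : ℕ) : ∃ C : ℝ, ∀ r w,
      ‖gaussMomentFun s x i j h r w‖ ≤ C * (Real.exp (1 * ‖w‖) * gauss w) := by
  obtain ⟨C, -, hC⟩ := hh.bounded hω
  exact ⟨_, fun r w => norm_gaussMomentFun_le hC w⟩

lemma OmegaDecay.integrable_gaussMomentFun (hω : IsWeightFn ω) (hh : OmegaDecay ω h) :
    Integrable (gaussMomentFun s x i j h r) := by
  obtain ⟨C, hC⟩ := hh.exists_norm_gaussMomentFun_le hω s x i j
  exact ((integrable_exp_norm_mul_gauss 1).const_mul C).mono'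
    (continuous_gaussMomentFun hh.1.continuous).aestronglyMeasurable (ae_of_all _ (hC r))

lemma hasDerivAt_comp_line (hh : Differentiable ℝ h) {γ : ℝ → ℝ × ℝ} {v : ℝ × ℝ} {t : ℝ}
    (hγ : HasDerivAt γ v t) : HasDerivAt (fun t => h (γ t))
      (Complex.I * (v.1 * D1 h (γ t) + v.2 * D2 h (γ t))) t := by
  rw [← fderiv_apply_eq_D1_D2]
  exact (hh (γ t)).hasFDerivAt.comp_hasDerivAt t hγ

lemma hasDerivAt_gaussMomentFun (hh : Differentiable ℝ h) (w : ℝ × ℝ) :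
    HasDerivAt (fun r => gaussMomentFun s x i j h r w)
      (Complex.I * s * (x.2 * gaussMomentFun s x (i + 1) j h r w -
          x.1 * gaussMomentFun s x i (j + 1) h r w) -
        2 * Complex.I * (gaussMomentFun s x (i + 1) j (D1 h) r w +
          gaussMomentFun s x i (j + 1) (D2 h) r w)) r := by
  have h1 : HasDerivAt (fun r : ℝ => x - (2 * r) • w) (-((2 : ℝ) • w)) r := by
    have := (((hasDerivAt_id r).const_mul 2).smul_const w).const_sub x
    simpa using this
  have h2 := hasDerivAt_comp_line hh h1
  have h3 : HasDerivAt
      (fun r : ℝ => Complex.I * ((r * s * (x.2 * w.1 - x.1 * w.2) : ℝ) : ℂ))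
      (Complex.I * ((s * (x.2 * w.1 - x.1 * w.2) : ℝ) : ℂ)) r := by
    have := ((hasDerivAt_id r).mul_const (s * (x.2 * w.1 - x.1 * w.2))).ofReal_comp.const_mul
      Complex.I
    simpa [mul_assoc] using this
  have h4 := ((h3.cexp.mul h2).const_mul ((w.1 : ℂ) ^ i * (w.2 : ℂ) ^ j)).const_mul (gauss w : ℂ)
  refine h4.congr_deriv ?_
  simp only [gaussMomentFun, Prod.fst_neg, Prod.snd_neg, Prod.smul_fst, Prod.smul_snd, smul_eq_mul]
  push_cast
  ring

lemma hasDerivAt_gaussMoment (hω : IsWeightFn ω) (hh : OmegaDecay ω h) :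
    HasDerivAt (gaussMoment s x i j h)
      (Complex.I * s * (x.2 * gaussMoment s x (i + 1) j h r -
          x.1 * gaussMoment s x i (j + 1) h r) -
        2 * Complex.I * (gaussMoment s x (i + 1) j (D1 h) r +
          gaussMoment s x i (j + 1) (D2 h) r)) r := by
  obtain ⟨C₁, hC₁⟩ := hh.exists_norm_gaussMomentFun_le hω s x (i + 1) j
  obtain ⟨C₂, hC₂⟩ := hh.exists_norm_gaussMomentFun_le hω s x i (j + 1)
  obtain ⟨C₃, hC₃⟩ := hh.D1.exists_norm_gaussMomentFun_le hω s x (i + 1) j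
  obtain ⟨C₄, hC₄⟩ := hh.D2.exists_norm_gaussMomentFun_le hω s x i (j + 1)
  have i₁ := hh.integrable_gaussMomentFun (s := s) (x := x) (r := r) (i := i + 1) (j := j) hω
  have i₂ := hh.integrable_gaussMomentFun (s := s) (x := x) (r := r) (i := i) (j := j + 1) hω
  have i₃ := hh.D1.integrable_gaussMomentFun (s := s) (x := x) (r := r) (i := i + 1) (j := j) hω
  have i₄ := hh.D2.integrable_gaussMomentFun (s := s) (x := x) (r := r) (i := i) (j := j + 1) hω
  have hint : Integrable fun w => Complex.I * s * (x.2 * gaussMomentFun s x (i + 1) j h r w -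
          x.1 * gaussMomentFun s x i (j + 1) h r w) -
        2 * Complex.I * (gaussMomentFun s x (i + 1) j (D1 h) r w +
          gaussMomentFun s x i (j + 1) (D2 h) r w) :=
    (((i₁.const_mul _).sub (i₂.const_mul _)).const_mul _).sub ((i₃.add i₄).const_mul _)
  have key := hasDerivAt_integral_of_dominated_loc_of_deriv_le (μ := (volume : Measure (ℝ × ℝ)))
    (F := fun r w => gaussMomentFun s x i j h r w) (x₀ := r) (s := Set.univ)
    (bound := fun w => (|s| * (|x.2| * C₁ + |x.1| * C₂) + 2 * (C₃ + C₄)) *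
      (Real.exp (1 * ‖w‖) * gauss w)) Filter.univ_mem
    (Filter.Eventually.of_forall fun r =>
      (continuous_gaussMomentFun hh.1.continuous).aestronglyMeasurable)
    (hh.integrable_gaussMomentFun hω) hint.1
    (ae_of_all _ fun w r _ => ?_) ((integrable_exp_norm_mul_gauss 1).const_mul _)
    (ae_of_all _ fun w r _ => hasDerivAt_gaussMomentFun (hh.1.differentiable (by simp)) w)
  · refine key.2.congr_deriv ?_
    simp only [gaussMoment]
    rw [integral_sub, integral_const_mul, integral_const_mul, integral_sub, integral_const_mul,
      integral_const_mul, integral_add i₃ i₄]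
    exacts [i₁.const_mul _, i₂.const_mul _, ((i₁.const_mul _).sub (i₂.const_mul _)).const_mul _,
      (i₃.add i₄).const_mul _]
  · set E := Real.exp (1 * ‖w‖) * gauss w
    calc _ ≤ |s| * (|x.2| * ‖gaussMomentFun s x (i + 1) j h r w‖ +
            |x.1| * ‖gaussMomentFun s x i (j + 1) h r w‖) +
          2 * (‖gaussMomentFun s x (i + 1) j (D1 h) r w‖ +
            ‖gaussMomentFun s x i (j + 1) (D2 h) r w‖) := by
          refine (norm_sub_le _ _).trans ?_
          rw [norm_mul, norm_mul, norm_mul, norm_mul, Complex.norm_I, Complex.norm_real,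
            Complex.norm_two, one_mul, mul_one, Real.norm_eq_abs]
          gcongr
          · refine (norm_sub_le _ _).trans ?_
            rw [norm_mul, norm_mul, Complex.norm_real, Complex.norm_real, Real.norm_eq_abs,
              Real.norm_eq_abs]
          · exact norm_add_le _ _
      _ ≤ |s| * (|x.2| * (C₁ * E) + |x.1| * (C₂ * E)) + 2 * (C₃ * E + C₄ * E) := by
          gcongr
          exacts [hC₁ r w, hC₂ r w, hC₃ r w, hC₄ r w]
      _ = _ := by ring

lemma continuous_gaussMoment (hω : IsWeightFn ω) (hh : OmegaDecay ω h) :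
    Continuous (gaussMoment s x i j h) :=
  continuous_iff_continuousAt.2 fun _ => (hasDerivAt_gaussMoment hω hh).continuousAt

lemma hasLineDerivAt_gaussMomentFun (hh : Differentiable ℝ h) (w v : ℝ × ℝ) :
    HasLineDerivAt ℝ (gaussMomentFun s x i j h r)
      (-2 * (v.1 * gaussMomentFun s x (i + 1) j h r w + v.2 * gaussMomentFun s x i (j + 1) h r w) +
        (i * v.1 * gaussMomentFun s x (i - 1) j h r w +
          j * v.2 * gaussMomentFun s x i (j - 1) h r w) +
        Complex.I * r * s * (x.2 * v.1 - x.1 * v.2) * gaussMomentFun s x i j h r w -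
        2 * Complex.I * r * (v.1 * gaussMomentFun s x i j (D1 h) r w +
          v.2 * gaussMomentFun s x i j (D2 h) r w)) w v := by
  have hw : HasDerivAt (fun t : ℝ => w + t • v) v 0 := by
    simpa using ((hasDerivAt_id (0 : ℝ)).smul_const v).const_add w
  have h1 : HasDerivAt (fun t : ℝ => (w + t • v).1) v.1 0 := by
    simpa using ((hasDerivAt_id (0 : ℝ)).mul_const v.1).const_add w.1
  have h2 : HasDerivAt (fun t : ℝ => (w + t • v).2) v.2 0 := by
    simpa using ((hasDerivAt_id (0 : ℝ)).mul_const v.2).const_add w.2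
  have hg : HasDerivAt (fun t : ℝ => (gauss (w + t • v) : ℂ))
      (-2 * (v.1 * w.1 + v.2 * w.2) * gauss w : ℂ) 0 := by
    have := (((h1.pow 2).add (h2.pow 2)).neg.exp).ofReal_comp
    refine this.congr_deriv ?_
    simp [gauss]
    ring
  have hp := (h1.ofReal_comp.pow i).mul (h2.ofReal_comp.pow j)
  have he := (((h1.const_mul x.2).sub (h2.const_mul x.1)).const_mul (r * s)).ofReal_comp.const_mul
    Complex.I
  have hc := hasDerivAt_comp_line hh ((hw.const_smul (2 * r)).const_sub x)
  refine (hg.mul (hp.mul (he.cexp.mul hc))).congr_deriv ?_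
  simp [gaussMomentFun]
  ring

/-- Integration by parts for Gaussian moments. -/
lemma gaussMoment_parts (hω : IsWeightFn ω) (hh : OmegaDecay ω h) (v : ℝ × ℝ) :
    -2 * (v.1 * gaussMoment s x (i + 1) j h r + v.2 * gaussMoment s x i (j + 1) h r) +
        (i * v.1 * gaussMoment s x (i - 1) j h r + j * v.2 * gaussMoment s x i (j - 1) h r) +
        Complex.I * r * s * (x.2 * v.1 - x.1 * v.2) * gaussMoment s x i j h r -
        2 * Complex.I * r * (v.1 * gaussMoment s x i j (D1 h) r +
          v.2 * gaussMoment s x i j (D2 h) r) = 0 := by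
  have I0 : ∀ i j, Integrable (gaussMomentFun s x i j h r) := fun i j =>
    hh.integrable_gaussMomentFun hω
  have I1 : ∀ i j, Integrable (gaussMomentFun s x i j (D1 h) r) := fun i j =>
    hh.D1.integrable_gaussMomentFun hω
  have I2 : ∀ i j, Integrable (gaussMomentFun s x i j (D2 h) r) := fun i j =>
    hh.D2.integrable_gaussMomentFun hω
  have a1 : Integrable fun w => -2 * (v.1 * gaussMomentFun s x (i + 1) j h r w +
      v.2 * gaussMomentFun s x i (j + 1) h r w) :=
    (((I0 (i + 1) j).const_mul _).add ((I0 i (j + 1)).const_mul _)).const_mul _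
  have a2 : Integrable fun w => i * v.1 * gaussMomentFun s x (i - 1) j h r w +
      j * v.2 * gaussMomentFun s x i (j - 1) h r w :=
    ((I0 (i - 1) j).const_mul _).add ((I0 i (j - 1)).const_mul _)
  have a3 : Integrable fun w =>
      Complex.I * r * s * (x.2 * v.1 - x.1 * v.2) * gaussMomentFun s x i j h r w :=
    (I0 i j).const_mul _
  have a4 : Integrable fun w => 2 * Complex.I * r * (v.1 * gaussMomentFun s x i j (D1 h) r w +
      v.2 * gaussMomentFun s x i j (D2 h) r w) :=
    (((I1 i j).const_mul _).add ((I2 i j).const_mul _)).const_mul _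
  have key := integral_bilinear_hasLineDerivAt_right_eq_neg_left_of_integrable
    (μ := (volume : Measure (ℝ × ℝ))) (B := ContinuousLinearMap.mul ℝ ℂ) (f := fun _ => 1)
    (f' := fun _ => 0) (v := v) (g := gaussMomentFun s x i j h r) (by simp)
    (by
      simp only [ContinuousLinearMap.mul_apply', one_mul]
      exact ((a1.add a2).add a3).sub a4)
    (by simpa using I0 i j)
    (fun w _ => hasDerivAt_const (0 : ℝ) (1 : ℂ))
    (fun w _ => hasLineDerivAt_gaussMomentFun (hh.1.differentiable (by simp)) w v)
  simp only [ContinuousLinearMap.mul_apply', one_mul, zero_mul, integral_zero, neg_zero] at key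
  rw [integral_sub, integral_add, integral_add, integral_const_mul, integral_const_mul,
    integral_const_mul, integral_add, integral_add, integral_add] at key
  simpa only [integral_const_mul, gaussMoment] using key
  exacts [(I1 i j).const_mul _, (I2 i j).const_mul _, (I0 (i - 1) j).const_mul _,
    (I0 i (j - 1)).const_mul _, (I0 (i + 1) j).const_mul _, (I0 i (j + 1)).const_mul _, a1, a2,
    a1.add a2, a3, (a1.add a2).add a3, a4]

end GaussMoment

section Green

variable {s r : ℝ} {x : ℝ × ℝ} {i j : ℕ} {h f : Fn2} {ω : ℝ → ℝ}

/-- The value at `x` of the twisted Laplacian applied to the slice with parameter `r` of the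
Green operator. -/
def greenSlice (s : ℝ) (x : ℝ × ℝ) (f : Fn2) (r : ℝ) : ℂ :=
  gaussMoment s x 0 0 (D1 (D1 f)) r - 2 * (r * s) * gaussMoment s x 0 1 (D1 f) r +
    (r * s) ^ 2 * gaussMoment s x 0 2 f r +
    (gaussMoment s x 0 0 (D2 (D2 f)) r + 2 * (r * s) * gaussMoment s x 1 0 (D2 f) r +
      (r * s) ^ 2 * gaussMoment s x 2 0 f r) -
    s * x.2 * (gaussMoment s x 0 0 (D1 f) r - (r * s) * gaussMoment s x 0 1 f r) +
    s * x.1 * (gaussMoment s x 0 0 (D2 f) r + (r * s) * gaussMoment s x 1 0 f r) +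
    s ^ 2 / 4 * (x.1 ^ 2 + x.2 ^ 2) * gaussMoment s x 0 0 f r

lemma hasDerivAt_gaussMoment_zero (hω : IsWeightFn ω) (hf : OmegaDecay ω f) (hs : s ^ 2 = 1) :
    ∃ m' : ℂ, HasDerivAt (gaussMoment s x 0 0 f) m' r ∧
      (1 - r ^ 4) * m' - 2 * r ^ 3 * gaussMoment s x 0 0 f r = -(2 * r) * greenSlice s x f r := by
  refine ⟨_, hasDerivAt_gaussMoment hω hf, ?_⟩
  have hs' : (s : ℂ) ^ 2 = 1 := by exact_mod_cast hs
  have e1 := gaussMoment_parts (s := s) (r := r) (x := x) (i := 0) (j := 0) hω hf (1, 0)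
  have e2 := gaussMoment_parts (s := s) (r := r) (x := x) (i := 0) (j := 0) hω hf (0, 1)
  have e3 := gaussMoment_parts (s := s) (r := r) (x := x) (i := 0) (j := 0) hω hf.D1 (1, 0)
  have e4 := gaussMoment_parts (s := s) (r := r) (x := x) (i := 0) (j := 0) hω hf.D2 (0, 1)
  have e5 := gaussMoment_parts (s := s) (r := r) (x := x) (i := 1) (j := 0) hω hf (1, 0)
  have e6 := gaussMoment_parts (s := s) (r := r) (x := x) (i := 0) (j := 1) hω hf (0, 1)
  have e7 := gaussMoment_parts (s := s) (r := r) (x := x) (i := 0) (j := 1) hω hf (1, 0)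
  have e8 := gaussMoment_parts (s := s) (r := r) (x := x) (i := 1) (j := 0) hω hf (0, 1)
  simp only [Nat.reduceAdd, Nat.reduceSub, Nat.cast_zero, Nat.cast_one, Complex.ofReal_zero,
    Complex.ofReal_one, zero_mul, mul_zero, one_mul, mul_one, add_zero, zero_add, sub_zero,
    zero_sub] at e1 e2 e3 e4 e5 e6 e7 e8 ⊢
  rw [greenSlice]
  have hI : Complex.I ^ 2 = -1 := Complex.I_sq
  linear_combination (exp := 1) (-(Complex.I * s * x.2 / 2)) * e1 +
    (Complex.I * s * x.1 / 2) * e2 + Complex.I * e3 + Complex.I * e4 - r ^ 3 * e5 - r ^ 3 * e6 -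
    2 * Complex.I * r * s * e7 + 2 * Complex.I * r * s * e8 +
    (-(2 * r * s * x.2 * gaussMoment s x 0 0 (D1 f) r) +
      2 * r * s * x.1 * gaussMoment s x 0 0 (D2 f) r +
      r * s ^ 2 * (x.1 ^ 2 + x.2 ^ 2) / 2 * gaussMoment s x 0 0 f r +
      2 * r * (gaussMoment s x 0 0 (D1 (D1 f)) r + gaussMoment s x 0 0 (D2 (D2 f)) r) -
      4 * r ^ 2 * s * (gaussMoment s x 0 1 (D1 f) r - gaussMoment s x 1 0 (D2 f) r) +
      2 * r ^ 2 * s ^ 2 * (x.2 * gaussMoment s x 0 1 f r + x.1 * gaussMoment s x 1 0 f r)) *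
        Complex.I_sq +
    2 * r ^ 3 * (gaussMoment s x 2 0 f r + gaussMoment s x 0 2 f r) * hs'

lemma continuous_greenSlice (hω : IsWeightFn ω) (hf : OmegaDecay ω f) :
    Continuous (greenSlice s x f) := by
  have h0 := fun i j => continuous_gaussMoment (s := s) (x := x) (i := i) (j := j) hω hf
  have h1 := fun i j => continuous_gaussMoment (s := s) (x := x) (i := i) (j := j) hω hf.D1
  have h2 := fun i j => continuous_gaussMoment (s := s) (x := x) (i := i) (j := j) hω hf.D2
  have h3 := continuous_gaussMoment (s := s) (x := x) (i := 0) (j := 0) hω hf.D1.D1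
  have h4 := continuous_gaussMoment (s := s) (x := x) (i := 0) (j := 0) hω hf.D2.D2
  unfold greenSlice
  fun_prop

lemma gaussMoment_zero : gaussMoment s x 0 0 f 0 = π * f x := by
  simp only [gaussMoment, gaussMomentFun, pow_zero, zero_mul, mul_zero, Complex.ofReal_zero,
    Complex.exp_zero, one_mul, zero_smul, sub_zero]
  rw [integral_mul_const, integral_complex_ofReal, integral_gauss]

/-- The slices of the Green operator are, up to sign, the derivative of
`cos τ * gaussMoment s x 0 0 f √(sin τ)`. -/
lemma integral_greenSlice (hω : IsWeightFn ω) (hf : OmegaDecay ω f) (hs : s ^ 2 = 1) :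
    ∫ τ in (0 : ℝ)..(π / 2), greenSlice s x f √(Real.sin τ) = π * f x := by
  have hM := continuous_gaussMoment (s := s) (x := x) (i := 0) (j := 0) hω hf
  have hN := continuous_greenSlice (s := s) (x := x) hω hf
  have key := intervalIntegral.integral_eq_sub_of_hasDerivAt_of_le (a := 0) (b := π / 2)
    (f := fun τ => -((Real.cos τ : ℂ) * gaussMoment s x 0 0 f √(Real.sin τ)))
    (f' := fun τ => greenSlice s x f √(Real.sin τ)) (by positivity)
    (Continuous.continuousOn (by fun_prop)) (fun τ hτ => ?_)
    (Continuous.intervalIntegrable (by fun_prop) _ _)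
  · rw [key]
    simp [gaussMoment_zero]
  · have hsin : 0 < Real.sin τ := Real.sin_pos_of_pos_of_lt_pi hτ.1 (by linarith [hτ.2, Real.pi_pos])
    have hr : 0 < √(Real.sin τ) := Real.sqrt_pos.2 hsin
    obtain ⟨m', hm', he⟩ := hasDerivAt_gaussMoment_zero (r := √(Real.sin τ)) (x := x) hω hf hs
    have h1 := (Real.hasDerivAt_sin τ).sqrt hsin.ne'
    have h2 := ((Real.hasDerivAt_cos τ).ofReal_comp.mul (hm'.scomp τ h1)).neg
    refine h2.congr_deriv ?_
    set r := √(Real.sin τ) with hrdef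
    have hr2 : r ^ 2 = Real.sin τ := Real.sq_sqrt hsin.le
    have hc : Real.cos τ ^ 2 = 1 - r ^ 4 := by
      have := Real.sin_sq_add_cos_sq τ
      have h4 : r ^ 4 = Real.sin τ ^ 2 := by rw [← hr2]; ring
      linarith
    have hcC : (Real.cos τ : ℂ) ^ 2 = 1 - (r : ℂ) ^ 4 := by exact_mod_cast hc
    have hrC : (r : ℂ) ≠ 0 := by exact_mod_cast hr.ne'
    have hsC : (Real.sin τ : ℂ) = (r : ℂ) ^ 2 := by exact_mod_cast hr2.symm
    simp only [Function.comp_apply, Complex.real_smul, Complex.ofReal_neg, Complex.ofReal_div,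
      Complex.ofReal_mul, Complex.ofReal_ofNat, hsC]
    field_simp
    linear_combination (-1 : ℂ) * he - m' * hcC

lemma heisOp_green_eq {k : ℝ × ℝ × ℝ → ℂ} (hd : IsHeisData greenShift (greenFreq s) (fun θ => 2 * ‖θ.2‖))
    (hk : ExpIntegrable greenMeasure (fun θ => 2 * ‖θ.2‖) k) {c : ℝ → ℂ}
    (hc : ∀ θ, k θ = c √(Real.sin θ.1) * ((θ.2.1 : ℂ) ^ i * (θ.2.2 : ℂ) ^ j) * greenDensity θ)
    (hω : IsWeightFn ω) (hh : OmegaDecay ω h) :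
    heisOp greenMeasure greenShift (greenFreq s) k h x =
      ∫ τ in (0 : ℝ)..(π / 2), (π : ℂ)⁻¹ * (c √(Real.sin τ) * gaussMoment s x i j h √(Real.sin τ)) := by
  obtain ⟨C, -, hC⟩ := hh.bounded hω
  have hi := hd.integrable hk hh.1.continuous hC x
  rw [heisOp, intervalIntegral.integral_of_le (by positivity), greenMeasure,
    integral_prod _ hi]
  congr 1
  funext τ
  rw [gaussMoment, ← integral_const_mul, ← integral_const_mul]
  congr 1
  funext w
  rw [hc, greenDensity, gaussMomentFun, greenShift, greenFreq]
  have : (√(Real.sin τ) * s) • ((-w.2, w.1) : ℝ × ℝ) = (-(√(Real.sin τ) * s * w.2), √(Real.sin τ) * s * w.1) := by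
    simp
  simp only [this]
  have h2 : -(√(Real.sin τ) * s * w.2) * x.1 + √(Real.sin τ) * s * w.1 * x.2 =
    √(Real.sin τ) * s * (x.2 * w.1 - x.1 * w.2) := by ring
  rw [h2]
  ring

lemma twistedLaplacian_apply {F : Fn2} (hF : ContDiff ℝ (⊤ : ℕ∞) F) :
    twistedLaplacian s F x = D1 (D1 F) x - s * x.2 * D1 F x + (D2 (D2 F) x + s * x.1 * D2 F x) +
      s ^ 2 / 4 * (x.1 ^ 2 + x.2 ^ 2) * F x := by
  have d0 : Differentiable ℝ F := hF.differentiable (by simp)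
  have d1 : Differentiable ℝ (D1 F) := hF.D1.differentiable (by simp)
  have d2 : Differentiable ℝ (D2 F) := hF.D2.differentiable (by simp)
  have hfst : HasFDerivAt (fun p : ℝ × ℝ => (p.1 : ℂ))
      (Complex.ofRealCLM.comp (ContinuousLinearMap.fst ℝ ℝ ℝ)) x :=
    (Complex.ofRealCLM.comp (ContinuousLinearMap.fst ℝ ℝ ℝ)).hasFDerivAt
  have hsnd : HasFDerivAt (fun p : ℝ × ℝ => (p.2 : ℂ))
      (Complex.ofRealCLM.comp (ContinuousLinearMap.snd ℝ ℝ ℝ)) x :=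
    (Complex.ofRealCLM.comp (ContinuousLinearMap.snd ℝ ℝ ℝ)).hasFDerivAt
  have h1 := D1_eq_of_hasFDerivAt (f := (D1 + (-(s / 2 : ℂ)) • M2) F)
    ((d1 x).hasFDerivAt.add ((hsnd.mul (d0 x).hasFDerivAt).const_smul (-(s / 2 : ℂ))))
  have h2 := D2_eq_of_hasFDerivAt (f := (D2 + (s / 2 : ℂ) • M1) F)
    ((d2 x).hasFDerivAt.add ((hfst.mul (d0 x).hasFDerivAt).const_smul (s / 2 : ℂ)))
  have e : twistedLaplacian s F x = D1 ((D1 + (-(s / 2 : ℂ)) • M2) F) x +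
      (-(s / 2 : ℂ)) * (x.2 * (D1 F x + (-(s / 2 : ℂ)) * (x.2 * F x))) +
      (D2 ((D2 + (s / 2 : ℂ) • M1) F) x +
      (s / 2 : ℂ) * (x.1 * (D2 F x + (s / 2 : ℂ) * (x.1 * F x)))) := rfl
  rw [e, h1, h2]
  simp [fderiv_apply_eq_D1_D2]
  ring_nf
  simp [Complex.I_sq]
  ring

lemma twistedLaplacian_green (hω : IsWeightFn ω) (hf : OmegaDecay ω f) (hs : s ^ 2 = 1) :
    twistedLaplacian s (green s f) = f := by
  funext x
  have hs1 : |s| ≤ 1 := by rw [← sq_le_one_iff_abs_le_one, hs]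
  have hd := isHeisData_green hs1
  have hk := expIntegrable_green
  have hk1 := hd.expIntegrable_fst_mul hk
  have hk2 := hd.expIntegrable_snd_mul hk
  have hT : ∀ {k h}, ExpIntegrable greenMeasure (fun θ => 2 * ‖θ.2‖) k → OmegaDecay ω h →
      Differentiable ℝ (heisOp greenMeasure greenShift (greenFreq s) k h) := fun hk hh =>
    (OmegaDecay.heisOp hω hd hk hh).1.differentiable (by simp)
  rw [green, twistedLaplacian_apply (OmegaDecay.heisOp hω hd hk hf).1, D1_heisOp hω hd hk hf,
    D1_add (hT hk hf.D1) (hT hk1 hf), D1_heisOp hω hd hk hf.D1, D1_heisOp hω hd hk1 hf,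
    D2_heisOp hω hd hk hf, D2_add (hT hk hf.D2) (hT hk2 hf), D2_heisOp hω hd hk hf.D2,
    D2_heisOp hω hd hk2 hf]
  simp only [Pi.add_apply]
  have c1 : ∀ θ : ℝ × ℝ × ℝ, (((greenFreq s θ).1 : ℝ) : ℂ) = -(√(Real.sin θ.1) * s) * θ.2.2 := by
    intro θ; simp [greenFreq]
  have c2 : ∀ θ : ℝ × ℝ × ℝ, (((greenFreq s θ).2 : ℝ) : ℂ) = (√(Real.sin θ.1) * s) * θ.2.1 := by
    intro θ; simp [greenFreq]
  have e00 : ∀ {h}, OmegaDecay ω h → _ := fun {h} hh => heisOp_green_eq (x := x) (i := 0) (j := 0)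
    (c := fun _ => 1) hd hk (fun θ => by simp) hω hh
  have e01 : ∀ {h}, OmegaDecay ω h → _ := fun {h} hh => heisOp_green_eq (x := x) (i := 0) (j := 1)
    (c := fun r => -(r * s)) hd hk1 (fun θ => by rw [c1]; ring) hω hh
  have e10 : ∀ {h}, OmegaDecay ω h → _ := fun {h} hh => heisOp_green_eq (x := x) (i := 1) (j := 0)
    (c := fun r => r * s) hd hk2 (fun θ => by rw [c2]; ring) hω hh
  have e02 := heisOp_green_eq (x := x) (i := 0) (j := 2)
    (c := fun r => (r * s) ^ 2) hd (hd.expIntegrable_fst_mul hk1)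
    (fun θ => by rw [c1]; ring) hω hf
  have e20 := heisOp_green_eq (x := x) (i := 2) (j := 0)
    (c := fun r => (r * s) ^ 2) hd (hd.expIntegrable_snd_mul hk2)
    (fun θ => by rw [c2]; ring) hω hf
  rw [e00 hf.D1.D1, e00 hf.D2.D2, e00 hf.D1, e00 hf.D2, e00 hf, e01 hf.D1, e01 hf, e10 hf.D2,
    e10 hf, e02, e20]
  have hm := fun {h} (hh : OmegaDecay ω h) i j =>
    continuous_gaussMoment (s := s) (x := x) (i := i) (j := j) hω hh
  have h00 := hm hf 0 0
  have h01 := hm hf 0 1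
  have h10 := hm hf 1 0
  have h02 := hm hf 0 2
  have h20 := hm hf 2 0
  have g00 := hm hf.D1 0 0
  have g01 := hm hf.D1 0 1
  have k00 := hm hf.D2 0 0
  have k10 := hm hf.D2 1 0
  have l00 := hm hf.D1.D1 0 0
  have n00 := hm hf.D2.D2 0 0
  have hfx : f x = ∫ τ in (0 : ℝ)..(π / 2), (π : ℂ)⁻¹ * greenSlice s x f √(Real.sin τ) := by
    rw [intervalIntegral.integral_const_mul, integral_greenSlice hω hf hs,
      inv_mul_cancel_left₀ (by exact_mod_cast Real.pi_ne_zero)]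
  rw [hfx]
  simp only [greenSlice]
  iterate 8 rw [← intervalIntegral.integral_add]
  · simp only [← intervalIntegral.integral_const_mul]
    rw [← intervalIntegral.integral_sub]
    · iterate 3 rw [← intervalIntegral.integral_add]
      · congr 1
        funext τ
        ring
      all_goals exact Continuous.intervalIntegrable (by fun_prop) _ _
    all_goals exact Continuous.intervalIntegrable (by fun_prop) _ _
  all_goals exact Continuous.intervalIntegrable (by fun_prop) _ _

end Green

theorem statement19 (ω : ℝ → ℝ) (hω : IsWeightFn ω)
    (L' : OmegaDist2 ω → OmegaDist2 ω) (hL' : DualCharOD2 ω L' LtwistT) :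
    RegOD2 ω L' := by
  rintro u ⟨f, hf, hrep⟩
  obtain ⟨g, hg, hgf⟩ := hf.exists_green hω (s := 1) (by simp)
  refine ⟨g, hg, fun φ => ?_⟩
  obtain ⟨ψ, hψ, hψφ⟩ := φ.2.exists_green hω (s := -1) (by simp)
  have hLg : twistedLaplacian 1 ⇑g = ⇑f := by
    rw [hgf, twistedLaplacian_green hω hf.omegaDecay (by norm_num)]
  have hLψ : twistedLaplacian (-1) ⇑ψ = ⇑φ.1 := by
    rw [hψφ, twistedLaplacian_green hω φ.2.omegaDecay (by norm_num)]
  rw [← hL' u ⟨ψ, hψ⟩ φ (by rw [LtwistT_eq, hLψ]), hrep, ← hLg,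
    integral_twistedLaplacian_mul, hLψ]
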